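/- arXiv:0811.1868 — 4 statements merged into one kernel-verified Lean document; each statement's English description precedes it below -/
import Mathlib

section
/- (Representation Theorem.) Let (M, φ) be a size pair with φ : M → ℝ real-valued. For every x̄ < ȳ, the value ℓ_{(M,φ)}(x̄, ȳ) equals the sum, over all proper cornerpoints (x, y) of ℓ_{(M,φ)} with x ≤ x̄ and y > ȳ, of the multiplicities μ((x, y)), plus the sum, over all cornerpoints at infinity (a, ∞) of ℓ_{(M,φ)} with a ≤ x̄, of the multiplicities μ((a, ∞)). -/
open scoped ENNReal Manifold
open Filter

noncomputable section

namespace SizeTheory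

/-- The 1-dimensional size function of the size pair `(M, φ)`: the number of connected
components of the sublevel set `{φ ≤ t}` containing at least one point of `{φ ≤ s}`. -/
def size1 {M : Type*} [TopologicalSpace M] (φ : M → ℝ) (s t : ℝ) : ℕ :=
  {S : Set M | ∃ P : M, φ P ≤ s ∧ S = connectedComponentIn {Q : M | φ Q ≤ t} P}.ncard

/-- The k-dimensional size function of the size pair `(M, φ)`: the number of connected
components of `M⟨φ ⪯ y⟩` containing at least one point of `M⟨φ ⪯ x⟩`. -/
def sizek {M : Type*} [TopologicalSpace M] {k : ℕ} (φ : M → Fin k → ℝ)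
    (x y : Fin k → ℝ) : ℕ :=
  {S : Set M | ∃ P : M, (∀ i, φ P i ≤ x i) ∧
    S = connectedComponentIn {Q : M | ∀ i, φ Q i ≤ y i} P}.ncard

/-- Multiplicity of a (candidate) proper cornerpoint `(x, y)` of a 1-dimensional size
function `ℓ`. -/
def mult (ℓ : ℝ → ℝ → ℕ) (x y : ℝ) : ℤ :=
  sInf {v : ℤ | ∃ ε : ℝ, 0 < ε ∧ x + ε < y - ε ∧
    v = (ℓ (x + ε) (y - ε) : ℤ) - (ℓ (x - ε) (y - ε) : ℤ)
      - (ℓ (x + ε) (y + ε) : ℤ) + (ℓ (x - ε) (y + ε) : ℤ)}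

/-- Multiplicity of a (candidate) cornerpoint at infinity `(a, ∞)` of a 1-dimensional size
function `ℓ`. -/
def multInf (ℓ : ℝ → ℝ → ℕ) (a : ℝ) : ℤ :=
  sInf {v : ℤ | ∃ ε : ℝ, 0 < ε ∧ a + ε < 1 / ε ∧
    v = (ℓ (a + ε) (1 / ε) : ℤ) - (ℓ (a - ε) (1 / ε) : ℤ)}

/-- `(x, y)` is a proper cornerpoint of the 1-dimensional size function `ℓ`. -/
def IsProperCornerpoint (ℓ : ℝ → ℝ → ℕ) (x y : ℝ) : Prop :=
  x < y ∧ 0 < mult ℓ x y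

/-- `(a, ∞)` is a cornerpoint at infinity (cornerline) of the 1-dimensional size
function `ℓ`. -/
def IsCornerpointAtInfinity (ℓ : ℝ → ℝ → ℕ) (a : ℝ) : Prop :=
  0 < multInf ℓ a

/-- The cost `(y - x)/2` of moving a point of `Δ̄*` (points `(x, y)` with `y` possibly `∞`)
onto the diagonal. -/
def diagHalf (p : ℝ × WithTop ℝ) : ℝ≥0∞ :=
  WithTop.recTopCoe ⊤ (fun y => ENNReal.ofReal ((y - p.1) / 2)) p.2

/-- `|y - y'|` for ordinates in `ℝ ∪ {∞}`, with the conventions `∞ - y = y - ∞ = ∞`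
for `y ≠ ∞` and `∞ - ∞ = 0`. -/
def yDist (y y' : WithTop ℝ) : ℝ≥0∞ :=
  WithTop.recTopCoe (WithTop.recTopCoe 0 (fun _ => (⊤ : ℝ≥0∞)) y')
    (fun a => WithTop.recTopCoe ⊤ (fun b => ENNReal.ofReal |a - b|) y') y

/-- The pseudometric `δ` used in the definition of the matching distance. -/
def deltaCP (p q : ℝ × WithTop ℝ) : ℝ≥0∞ :=
  min (max (ENNReal.ofReal |p.1 - q.1|) (yDist p.2 q.2)) (max (diagHalf p) (diagHalf q))

/-- The multiplicity, in the augmented multiset of cornerpoints of the 1-dimensional size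
function `ℓ`, of a point `p` of `Δ̄*`: cornerpoints (proper or at infinity) are counted
with their multiplicities, and the points of the diagonal with infinite multiplicity. -/
def cpMult (ℓ : ℝ → ℝ → ℕ) (p : ℝ × WithTop ℝ) : ℕ∞ :=
  WithTop.recTopCoe ((multInf ℓ p.1).toNat : ℕ∞)
    (fun y => if p.1 = y then (⊤ : ℕ∞)
      else if p.1 < y then ((mult ℓ p.1 y).toNat : ℕ∞) else 0) p.2

/-- The underlying "index type" of a multiset of points of `Δ̄*` described by the
multiplicity function `m`: each point `p` appears with multiplicity `m p`. -/
def CPIdx (m : ℝ × WithTop ℝ → ℕ∞) : Type :=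
  Σ p : ℝ × WithTop ℝ, {n : ℕ // (n : ℕ∞) < m p}

/-- The matching distance between two 1-dimensional size functions: the infimum, over all
bijections `σ` between the two augmented multisets of cornerpoints, of the supremum of
`δ(P, σ(P))`. -/
def dMatch (ℓ₁ ℓ₂ : ℝ → ℝ → ℕ) : ℝ≥0∞ :=
  ⨅ σ : CPIdx (cpMult ℓ₁) ≃ CPIdx (cpMult ℓ₂),
    ⨆ a : CPIdx (cpMult ℓ₁), deltaCP a.1 ((σ a).1)

/-- `(l, b)` is an admissible pair: `l` is a unit vector (Euclidean norm) with strictly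
positive components, and the components of `b` sum to zero. -/
def Admissible {k : ℕ} (l b : Fin k → ℝ) : Prop :=
  Real.sqrt (∑ i, l i ^ 2) = 1 ∧ (∀ i, 0 < l i) ∧ ∑ i, b i = 0

/-- The 1-dimensional measuring function `F_{(l,b)}^φ (P) = max_i (φ_i(P) - b_i)/l_i`
corresponding to the half-plane `π_{(l,b)}`. -/
def Fpair {M : Type*} {k : ℕ} (φ : M → Fin k → ℝ) (l b : Fin k → ℝ) (P : M) : ℝ :=
  ⨆ i, (φ P i - b i) / l i

section ManifoldDefs

variable {E : Type*} [NormedAddCommGroup E] [InnerProductSpace ℝ E] [FiniteDimensional ℝ E]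
  {H : Type*} [TopologicalSpace H] (I : ModelWithCorners ℝ E H)
  {M : Type*} [TopologicalSpace M] [ChartedSpace H M]

/-- The differential (gradient, up to the Riemannian identification) at `Q` of the `i`-th
component of `φ : M → ℝ^k`, seen as a covector at `Q`. -/
def dcomp {k : ℕ} (φ : M → Fin k → ℝ) (Q : M) (i : Fin k) :
    TangentSpace I Q →L[ℝ] ℝ :=
  mfderiv I 𝓘(ℝ, ℝ) (fun P => φ P i) Q

/-- `Q` is an `(l, b)`-pseudocritical point for `φ`: the convex hull of the differentials
`dφ_i(Q)`, for the indices `i ∈ I_Q` realizing the maximum defining `F_{(l,b)}^φ (Q)`,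
contains the null (co)vector. -/
def LBPseudocritPt {k : ℕ} (l b : Fin k → ℝ) (φ : M → Fin k → ℝ) (Q : M) : Prop :=
  ∃ lam : Fin k → ℝ, (∀ i, 0 ≤ lam i) ∧ (∀ i, lam i ≤ 1) ∧
    (∀ i, lam i ≠ 0 → (φ Q i - b i) / l i = Fpair φ l b Q) ∧
    (∑ i, lam i) = 1 ∧ (∑ i, lam i • dcomp I φ Q i) = 0

/-- `c` is an `(l, b)`-pseudocritical value for `φ`. -/
def LBPseudocritVal {k : ℕ} (l b : Fin k → ℝ) (φ : M → Fin k → ℝ) (c : ℝ) : Prop :=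
  ∃ Q : M, Fpair φ l b Q = c ∧ LBPseudocritPt I l b φ Q

/-- `ξ : M → ℝ^h` is `C¹` at the point `Q`. -/
def C1At {h : ℕ} (ξ : M → Fin h → ℝ) (Q : M) : Prop :=
  ∀ j, ContMDiffAt I 𝓘(ℝ, ℝ) 1 (fun P => ξ P j) Q

/-- `Q` is a pseudocritical point for `ξ : M → ℝ^h`: `ξ` is `C¹` at `Q` and the convex hull
of the differentials `dξ_1(Q), …, dξ_h(Q)` contains the null (co)vector. -/
def PseudocritPt {h : ℕ} (ξ : M → Fin h → ℝ) (Q : M) : Prop :=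
  C1At I ξ Q ∧
  ∃ lam : Fin h → ℝ, (∀ j, 0 ≤ lam j) ∧ (∀ j, lam j ≤ 1) ∧
    (∑ j, lam j) = 1 ∧ (∑ j, lam j • dcomp I ξ Q j) = 0

/-- `v` is a pseudocritical value for `ξ`. -/
def PseudocritVal {h : ℕ} (ξ : M → Fin h → ℝ) (v : Fin h → ℝ) : Prop :=
  ∃ Q : M, ξ Q = v ∧ PseudocritPt I ξ Q

/-- `v` is a special value for `ξ`: `v` is the image of a point at which `ξ` is not `C¹`. -/
def SpecialVal {h : ℕ} (ξ : M → Fin h → ℝ) (v : Fin h → ℝ) : Prop :=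
  ∃ Q : M, ξ Q = v ∧ ¬ C1At I ξ Q

end ManifoldDefs

section Topology

open scoped Topology

/-- Points of a set on which a continuous real function exceeds `c` keep exceeding values slightly
larger than `c` when the set is compact. -/
theorem eventually_forall_lt_of_isCompact {X : Type*} [TopologicalSpace X] {f : X → ℝ}
    (hf : Continuous f) {K : Set X} (hK : IsCompact K) {c : ℝ} (hc : ∀ P ∈ K, c < f P) :
    ∀ᶠ c' in 𝓝[>] c, ∀ P ∈ K, c' < f P := by
  rcases K.eq_empty_or_nonempty with rfl | hne
  · simp
  obtain ⟨P, hP, hmin⟩ := hK.exists_isMinOn hne hf.continuousOn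
  filter_upwards [mem_nhdsWithin_of_mem_nhds (Iio_mem_nhds (hc P hP))] with c' hc' Q hQ
  exact lt_of_lt_of_le hc' (hmin hQ)

section Topological

variable {M : Type*} [TopologicalSpace M] {φ : M → ℝ}

/-- The connected component of `P` in the sublevel set `{φ ≤ t}`. -/
def sublevelComponent (φ : M → ℝ) (t : ℝ) (P : M) : Set M :=
  connectedComponentIn {Q : M | φ Q ≤ t} P

/-- The connected components of `{φ ≤ t}` meeting `{φ ≤ s}`. -/
def sublevelComponents (φ : M → ℝ) (s t : ℝ) : Set (Set M) :=
  sublevelComponent φ t '' {P : M | φ P ≤ s}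

theorem size1_eq_ncard (φ : M → ℝ) (s t : ℝ) :
    size1 φ s t = (sublevelComponents φ s t).ncard := by
  simp only [size1, sublevelComponents, sublevelComponent, Set.image, Set.mem_ofPred_eq,
    eq_comm (a := connectedComponentIn _ _)]

theorem sublevelComponents_mono {s s' : ℝ} (h : s ≤ s') (t : ℝ) :
    sublevelComponents φ s t ⊆ sublevelComponents φ s' t :=
  Set.image_mono fun _ hP => le_trans hP h

theorem mem_sublevelComponent {t : ℝ} {P : M} (h : φ P ≤ t) : P ∈ sublevelComponent φ t P :=
  mem_connectedComponentIn h

theorem le_of_mem_sublevelComponent {t : ℝ} {P Q : M} (h : Q ∈ sublevelComponent φ t P) :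
    φ Q ≤ t :=
  connectedComponentIn_subset {R : M | φ R ≤ t} P h

theorem sublevelComponent_eq_of_le {t t' : ℝ} (h : t ≤ t') {P Q : M}
    (hQ : Q ∈ sublevelComponent φ t P) :
    sublevelComponent φ t' P = sublevelComponent φ t' Q :=
  connectedComponentIn_eq
    (connectedComponentIn_mono P (fun _ hR => le_trans hR h : {R | φ R ≤ t} ⊆ {R | φ R ≤ t'}) hQ)

theorem finite_sublevelComponents [CompactSpace M] [LocallyConnectedSpace M]
    (hφ : Continuous φ) {s t : ℝ} (hst : s < t) : (sublevelComponents φ s t).Finite := by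
  have hK : IsCompact {P : M | φ P ≤ s} := (isClosed_le hφ continuous_const).isCompact
  have hU : IsOpen {P : M | φ P < t} := isOpen_lt hφ continuous_const
  obtain ⟨F, hF⟩ := hK.elim_nhds_subcover' (fun P _ => connectedComponentIn {P | φ P < t} P)
    (fun P hP => (hU.connectedComponentIn).mem_nhds
      (mem_connectedComponentIn (lt_of_le_of_lt hP hst)))
  refine (F.finite_toSet.image fun P => sublevelComponent φ t P.1).subset ?_
  rintro _ ⟨Q, hQ, rfl⟩
  obtain ⟨P, hP, hQP⟩ := Set.mem_iUnion₂.1 (hF hQ)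
  exact ⟨P, hP, connectedComponentIn_eq
    (connectedComponentIn_mono _
      (fun R hR => (show φ R < t from hR).le : {R | φ R < t} ⊆ {R | φ R ≤ t}) hQP)⟩

/-- The union of the connected components of `{φ ≤ t}` through the points of `T`. -/
def sublevelSaturation (φ : M → ℝ) (t : ℝ) (T : Set M) : Set M :=
  ⋃ P ∈ T, sublevelComponent φ t P

theorem sublevelSaturation_sublevelComponent {t t' : ℝ} (h : t ≤ t') {P : M} (hP : φ P ≤ t) :
    sublevelSaturation φ t' (sublevelComponent φ t P) = sublevelComponent φ t' P := by
  apply subset_antisymm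
  · refine Set.iUnion₂_subset fun Q hQ => ?_
    rw [sublevelComponent_eq_of_le h hQ]
  · exact Set.subset_biUnion_of_mem (u := sublevelComponent φ t') (mem_sublevelComponent hP)

theorem image_sublevelSaturation_sublevelComponents {s t t' : ℝ} (hst : s ≤ t) (htt' : t ≤ t') :
    sublevelSaturation φ t' '' sublevelComponents φ s t = sublevelComponents φ s t' := by
  rw [sublevelComponents, Set.image_image]
  exact Set.image_congr fun P hP =>
    sublevelSaturation_sublevelComponent htt' (le_trans hP hst)

theorem ncard_sublevelComponents_sdiff_le [CompactSpace M] [LocallyConnectedSpace M]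
    (hφ : Continuous φ) {s s' t t' : ℝ} (hss' : s ≤ s') (hs't : s' < t) (htt' : t ≤ t') :
    (sublevelComponents φ s' t' \ sublevelComponents φ s t').ncard ≤
      (sublevelComponents φ s' t \ sublevelComponents φ s t).ncard := by
  have hfin : (sublevelComponents φ s' t \ sublevelComponents φ s t).Finite :=
    (finite_sublevelComponents hφ hs't).subset Set.sdiff_subset
  refine (Set.ncard_le_ncard ?_ (hfin.image (sublevelSaturation φ t'))).trans
    (Set.ncard_image_le hfin)
  rw [← image_sublevelSaturation_sublevelComponents hs't.le htt',
    ← image_sublevelSaturation_sublevelComponents (hss'.trans hs't.le) htt']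
  rintro _ ⟨⟨T, hT, rfl⟩, hTs⟩
  exact ⟨T, ⟨hT, fun h => hTs ⟨T, h, rfl⟩⟩, rfl⟩

theorem eventually_sublevelComponents_eq_left [CompactSpace M] [LocallyConnectedSpace M]
    (hφ : Continuous φ) {s t : ℝ} (hst : s < t) :
    ∀ᶠ s' in 𝓝[>] s, sublevelComponents φ s' t = sublevelComponents φ s t := by
  obtain ⟨u, hsu, hut⟩ := exists_between hst
  have key : ∀ T ∈ sublevelComponents φ u t \ sublevelComponents φ s t,
      ∀ᶠ s' in 𝓝[>] s, ∀ P ∈ T, s' < φ P := by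
    rintro _ ⟨⟨P, hP, rfl⟩, hPs⟩
    have hPt : φ P ≤ t := le_trans hP hut.le
    refine eventually_forall_lt_of_isCompact hφ ?_ fun Q hQ => ?_
    · have hcl : IsClosed {Q : M | φ Q ≤ t} := isClosed_le hφ continuous_const
      refine IsClosed.isCompact (isClosed_of_closure_subset ?_)
      exact (isPreconnected_connectedComponentIn.closure).subset_connectedComponentIn
        (subset_closure (mem_connectedComponentIn hPt))
        (closure_minimal (connectedComponentIn_subset _ _) hcl)
    · by_contra! hQs
      exact hPs ⟨Q, hQs, (connectedComponentIn_eq hQ).symm⟩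
  have hfin := (finite_sublevelComponents hφ hut).subset
    (Set.sdiff_subset (t := sublevelComponents φ s t))
  filter_upwards [hfin.eventually_all.2 key, Ioo_mem_nhdsGT hsu] with s' hs' hsu'
  refine subset_antisymm ?_ (sublevelComponents_mono hsu'.1.le t)
  rintro _ ⟨P, hP, rfl⟩
  by_contra hPs
  exact (hs' _ ⟨⟨P, le_trans hP hsu'.2.le, rfl⟩, hPs⟩ P
    (mem_sublevelComponent (le_trans hP (hsu'.2.trans hut).le))).not_ge hP

theorem eventually_sublevelComponent_ne [CompactSpace M] [T2Space M] (hφ : Continuous φ)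
    {t : ℝ} {P Q : M} (hP : φ P ≤ t) (hQ : φ Q ≤ t)
    (hPQ : sublevelComponent φ t P ≠ sublevelComponent φ t Q) :
    ∀ᶠ t' in 𝓝[>] t, sublevelComponent φ t' P ≠ sublevelComponent φ t' Q := by
  have hcl : IsClosed {R : M | φ R ≤ t} := isClosed_le hφ continuous_const
  have : CompactSpace {R : M | φ R ≤ t} := isCompact_iff_compactSpace.1 hcl.isCompact
  have hQC : (⟨Q, hQ⟩ : {R : M | φ R ≤ t}) ∉ connectedComponent ⟨P, hP⟩ := fun h =>
    hPQ (connectedComponentIn_eq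
      ((connectedComponentIn_eq_image (F := {R : M | φ R ≤ t}) hP).symm ▸ ⟨_, h, rfl⟩))
  rw [connectedComponent_eq_iInter_isClopen] at hQC
  simp only [Set.mem_iInter, not_forall] at hQC
  obtain ⟨⟨Z, hZ, hPZ⟩, hQZ⟩ := hQC
  obtain ⟨U, V, hU, hV, hZU, hZV, hUV⟩ := normal_separation
    (hcl.isClosedEmbedding_subtypeVal.isClosedMap Z hZ.1)
    (hcl.isClosedEmbedding_subtypeVal.isClosedMap Zᶜ hZ.2.isClosed_compl)
    ((Set.disjoint_image_iff Subtype.val_injective).2 disjoint_compl_right)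
  have hout : ∀ R ∈ (U ∪ V)ᶜ, t < φ R := by
    intro R hR
    by_contra! hRt
    by_cases hRZ : (⟨R, hRt⟩ : {R : M | φ R ≤ t}) ∈ Z
    · exact hR (Or.inl (hZU ⟨_, hRZ, rfl⟩))
    · exact hR (Or.inr (hZV ⟨_, hRZ, rfl⟩))
  filter_upwards [eventually_forall_lt_of_isCompact hφ
    (hU.union hV).isClosed_compl.isCompact hout, self_mem_nhdsWithin] with t' ht' htt' heq
  have hsub : sublevelComponent φ t' P ⊆ U ∪ V := fun R hR => by
    by_contra hRUV
    exact (ht' R hRUV).not_ge (le_of_mem_sublevelComponent hR)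
  have hPt' : φ P ≤ t' := le_trans hP (le_of_lt htt')
  have hQt' : φ Q ≤ t' := le_trans hQ (le_of_lt htt')
  have hleft : sublevelComponent φ t' P ⊆ U :=
    isPreconnected_connectedComponentIn.subset_left_of_subset_union hU hV hUV hsub
      ⟨P, mem_sublevelComponent hPt', hZU ⟨_, hPZ, rfl⟩⟩
  exact Set.disjoint_left.1 hUV (hleft (heq ▸ mem_sublevelComponent hQt')) (hZV ⟨_, hQZ, rfl⟩)

theorem eventually_ncard_sublevelComponents_eq_right [CompactSpace M] [LocallyConnectedSpace M]
    [T2Space M] (hφ : Continuous φ) {s t : ℝ} (hst : s < t) :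
    ∀ᶠ t' in 𝓝[>] t, (sublevelComponents φ s t').ncard = (sublevelComponents φ s t).ncard := by
  have hfin := finite_sublevelComponents hφ hst
  have key : ∀ T ∈ sublevelComponents φ s t, ∀ T' ∈ sublevelComponents φ s t, T ≠ T' →
      ∀ᶠ t' in 𝓝[>] t, ∀ P ∈ T, ∀ Q ∈ T', sublevelComponent φ t' P ≠ sublevelComponent φ t' Q := by
    rintro _ ⟨P, hP, rfl⟩ _ ⟨Q, hQ, rfl⟩ hne
    filter_upwards [eventually_sublevelComponent_ne hφ (le_trans hP hst.le) (le_trans hQ hst.le)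
      hne, self_mem_nhdsWithin] with t' ht' htt' P' hP' Q' hQ'
    rwa [← sublevelComponent_eq_of_le (le_of_lt htt') hP',
      ← sublevelComponent_eq_of_le (le_of_lt htt') hQ']
  have key' : ∀ᶠ t' in 𝓝[>] t, ∀ T ∈ sublevelComponents φ s t, ∀ T' ∈ sublevelComponents φ s t,
      T ≠ T' → ∀ P ∈ T, ∀ Q ∈ T', sublevelComponent φ t' P ≠ sublevelComponent φ t' Q := by
    simp only [hfin.eventually_all, eventually_imp_distrib_left]
    exact key
  filter_upwards [key', self_mem_nhdsWithin] with t' ht' htt'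
  rw [← image_sublevelSaturation_sublevelComponents hst.le (le_of_lt htt')]
  refine Set.InjOn.ncard_image fun T hT T' hT' heq => ?_
  by_contra hne
  obtain ⟨P, hP, rfl⟩ := id hT
  obtain ⟨Q, hQ, rfl⟩ := id hT'
  have hPt : φ P ≤ t := le_trans hP hst.le
  have hQt : φ Q ≤ t := le_trans hQ hst.le
  rw [sublevelSaturation_sublevelComponent (le_of_lt htt') hPt,
    sublevelSaturation_sublevelComponent (le_of_lt htt') hQt] at heq
  exact ht' _ hT _ hT' hne P (mem_sublevelComponent hPt) Q (mem_sublevelComponent hQt) heq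

end Topological

section StepFunctions

theorem eventually_eq_leftLim {g : ℝ → ℕ} (hg : Monotone g) (a : ℝ) :
    ∀ᶠ s in 𝓝[<] a, g s = Function.leftLim g a := by
  have h := hg.tendsto_leftLim a
  rwa [nhds_discrete, tendsto_pure] at h

/-- The final value of a monotone right-continuous step function, which is constant outside a
bounded interval and starts from `0`, is the sum of its jumps. -/
theorem tsum_jumps_eq {g : ℝ → ℕ} (hg : Monotone g)
    (hright : ∀ x, ∀ᶠ x' in 𝓝[>] x, g x' = g x) {N : ℕ} {c d : ℝ} (hc : ∀ x < c, g x = 0)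
    (hd : ∀ x, d ≤ x → g x = N) :
    ∑' a : ℝ, ((g a - Function.leftLim g a : ℕ) : ℝ≥0∞) = N := by
  have hle : ∀ x, g x ≤ N := fun x => (hg (le_max_left x d)).trans (hd _ (le_max_right x d)).le
  have hex : ∀ k, ∃ p, k < N → ∀ x, k < g x ↔ p ≤ x := by
    intro k
    refine ⟨sInf {x | k < g x}, fun hk x => ?_⟩
    have hbdd : BddBelow {x | k < g x} := ⟨c, fun x hx => by
      by_contra! h
      have : k < g x := hx
      rw [hc x h] at this
      omega⟩
    have hne : {x | k < g x}.Nonempty := ⟨d, show k < g d by rwa [hd d le_rfl]⟩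
    refine ⟨fun h => csInf_le hbdd h, fun h => lt_of_lt_of_le ?_ (hg h)⟩
    by_contra! hk'
    obtain ⟨u, hu, huI⟩ := mem_nhdsGT_iff_exists_Ioo_subset.1 (hright (sInf {x | k < g x}))
    obtain ⟨x, hx, hxu⟩ := exists_lt_of_csInf_lt hne hu
    have hx' : k < g x := hx
    rcases (csInf_le hbdd hx).eq_or_lt with h | h
    · rw [← h] at hx'
      omega
    · have : g x = _ := huI ⟨h, hxu⟩
      omega
  choose p hp using hex
  have hfib : ∀ a, (Finset.range N).filter (fun k => a = p k) =
      Finset.Ico (Function.leftLim g a) (g a) := by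
    intro a
    ext k
    simp only [Finset.mem_filter, Finset.mem_range, Finset.mem_Ico]
    obtain ⟨s, hs, hsa⟩ := ((eventually_eq_leftLim hg a).and self_mem_nhdsWithin).exists
    have hsa' : s < a := hsa
    constructor
    · rintro ⟨hk, rfl⟩
      refine ⟨?_, (hp k hk _).2 le_rfl⟩
      rw [← hs]
      by_contra! h
      exact ((hp k hk _).1 h).not_gt hsa'
    · rintro ⟨h1, h2⟩
      have hk : k < N := h2.trans_le (hle a)
      refine ⟨hk, le_antisymm ?_ ((hp k hk a).1 h2)⟩
      by_contra! h
      exact (((hp k hk _).2 le_rfl).trans_le (hg.le_leftLim h)).not_ge h1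
  calc ∑' a : ℝ, ((g a - Function.leftLim g a : ℕ) : ℝ≥0∞)
      = ∑' a : ℝ, ∑ k ∈ Finset.range N, if a = p k then 1 else 0 := by
        refine tsum_congr fun a => ?_
        rw [← Nat.card_Ico, ← hfib, Finset.card_filter]
        push_cast
        rfl
    _ = ∑ k ∈ Finset.range N, ∑' a : ℝ, if a = p k then 1 else 0 :=
        Summable.tsum_finsetSum fun _ _ => ENNReal.summable
    _ = N := by simp [tsum_ite_eq]

end StepFunctions

/-- The properties of size functions from which the representation by cornerpoints follows. -/
structure IsStepSurface (ℓ : ℝ → ℝ → ℕ) (c d : ℝ) : Prop where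
  eq_zero : ∀ s t, s < c → s < t → ℓ s t = 0
  eq_top : ∀ s t, d ≤ t → ℓ s t = ℓ s d
  mono : ∀ s s' t, s ≤ s' → s' < t → ℓ s t ≤ ℓ s' t
  rect : ∀ s s' t t', s ≤ s' → s' < t → t ≤ t' → ℓ s' t' + ℓ s t ≤ ℓ s' t + ℓ s t'
  right_fst : ∀ s t, s < t → ∀ᶠ s' in 𝓝[>] s, ℓ s' t = ℓ s t
  right_snd : ∀ s t, s < t → ∀ᶠ t' in 𝓝[>] t, ℓ s t' = ℓ s t

theorem isStepSurface_size1 {M : Type*} [TopologicalSpace M] [Nonempty M]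
    [CompactSpace M] [LocallyConnectedSpace M] [T2Space M] {φ : M → ℝ} (hφ : Continuous φ) :
    ∃ c d, IsStepSurface (size1 φ) c d := by
  obtain ⟨m, -, hm⟩ := isCompact_univ.exists_isMinOn Set.univ_nonempty hφ.continuousOn
  obtain ⟨n, -, hn⟩ := isCompact_univ.exists_isMaxOn Set.univ_nonempty hφ.continuousOn
  have hmin : ∀ P, φ m ≤ φ P := fun P => hm (Set.mem_univ P)
  have hmax : ∀ P, φ P ≤ φ n := fun P => hn (Set.mem_univ P)
  refine ⟨φ m, φ n, ?_, ?_, ?_, ?_, ?_, ?_⟩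
  · intro s t hs _
    have : {P : M | φ P ≤ s} = ∅ :=
      Set.eq_empty_of_forall_notMem fun P hP => (hs.trans_le (hmin P)).not_ge hP
    simp [size1_eq_ncard, sublevelComponents, this]
  · intro s t ht
    have h : ∀ u, φ n ≤ u → {P : M | φ P ≤ u} = Set.univ := fun u hu =>
      Set.eq_univ_of_forall fun P => (hmax P).trans hu
    have heq : sublevelComponent φ t = sublevelComponent φ (φ n) := by
      funext P
      simp only [sublevelComponent, h t ht, h _ le_rfl]
    simp only [size1_eq_ncard, sublevelComponents, heq]
  · intro s s' t hs ht
    simp only [size1_eq_ncard]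
    exact Set.ncard_le_ncard (sublevelComponents_mono hs t) (finite_sublevelComponents hφ ht)
  · intro s s' t t' hs ht ht'
    simp only [size1_eq_ncard]
    have h := ncard_sublevelComponents_sdiff_le hφ hs ht ht'
    have h1 := Set.ncard_sdiff_add_ncard_of_subset (sublevelComponents_mono (φ := φ) hs t)
      (finite_sublevelComponents hφ ht)
    have h2 := Set.ncard_sdiff_add_ncard_of_subset (sublevelComponents_mono (φ := φ) hs t')
      (finite_sublevelComponents hφ (ht.trans_le ht'))
    omega
  · intro s t hst
    filter_upwards [eventually_sublevelComponents_eq_left hφ hst] with s' hs'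
    rw [size1_eq_ncard, size1_eq_ncard, hs']
  · intro s t hst
    simpa only [size1_eq_ncard] using eventually_ncard_sublevelComponents_eq_right hφ hst

section Multiplicities

variable {ℓ : ℝ → ℝ → ℕ} {c d x₀ y₀ : ℝ}

/-- The function `ℓ` on the horizontal line of ordinate `y`, frozen beyond the abscissa `x₀`. -/
def truncRow (ℓ : ℝ → ℝ → ℕ) (x₀ y x : ℝ) : ℕ := ℓ (min x x₀) y

/-- The jump at `a` of `ℓ`, frozen beyond `x₀`, on the line of ordinate `y`. -/
def rowJump (ℓ : ℝ → ℝ → ℕ) (x₀ a y : ℝ) : ℕ :=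
  truncRow ℓ x₀ y a - Function.leftLim (truncRow ℓ x₀ y) a

/-- The amount by which the jump at `a` has decreased between the ordinates `y₀` and `y`. -/
def rowJumpLoss (ℓ : ℝ → ℝ → ℕ) (x₀ y₀ a y : ℝ) : ℕ :=
  rowJump ℓ x₀ a y₀ - rowJump ℓ x₀ a (max y y₀)

namespace IsStepSurface

theorem truncRow_mono (h : IsStepSurface ℓ c d) {y : ℝ} (hy : x₀ < y) :
    Monotone (truncRow ℓ x₀ y) := fun _ _ hab =>
  h.mono _ _ _ (min_le_min_right _ hab) ((min_le_right _ _).trans_lt hy)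

theorem truncRow_rect (h : IsStepSurface ℓ c d) {s s' t t' : ℝ} (hs : s ≤ s') (ht : x₀ < t)
    (htt' : t ≤ t') :
    truncRow ℓ x₀ t' s' + truncRow ℓ x₀ t s ≤ truncRow ℓ x₀ t s' + truncRow ℓ x₀ t' s :=
  h.rect _ _ _ _ (min_le_min_right _ hs) ((min_le_right _ _).trans_lt ht) htt'

theorem eq_of_eq (h : IsStepSurface ℓ c d) {s s' t t' : ℝ} (hs : s ≤ s') (ht : s' < t)
    (htt' : t ≤ t') (heq : ℓ s' t = ℓ s t) : ℓ s' t' = ℓ s t' := by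
  have h1 := h.rect s s' t t' hs ht htt'
  have h2 := h.mono s s' t' hs (ht.trans_le htt')
  omega

theorem eventually_leftLim_eq (h : IsStepSurface ℓ c d) (hxy : x₀ < y₀) (a : ℝ) :
    ∀ᶠ s in 𝓝[<] a, ∀ y, y₀ ≤ y → Function.leftLim (truncRow ℓ x₀ y) a = truncRow ℓ x₀ y s := by
  obtain ⟨u, hu, huI⟩ := mem_nhdsLT_iff_exists_Ioo_subset.1
    (eventually_eq_leftLim (h.truncRow_mono hxy) a)
  filter_upwards [Ioo_mem_nhdsLT hu] with s hs y hy
  obtain ⟨s', hs', hs'I⟩ := ((eventually_eq_leftLim (h.truncRow_mono (hxy.trans_le hy)) a).and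
    (Ioo_mem_nhdsLT hs.2)).exists
  rw [← hs']
  have h1 : truncRow ℓ x₀ y₀ s = _ := huI hs
  have h2 : truncRow ℓ x₀ y₀ s' = _ := huI ⟨hs.1.trans hs'I.1, hs'I.2⟩
  exact h.eq_of_eq (min_le_min_right _ hs'I.1.le) ((min_le_right _ _).trans_lt hxy) hy
    (h2.trans h1.symm)

theorem exists_leftLim_eq (h : IsStepSurface ℓ c d) (hxy : x₀ < y₀) (a : ℝ) :
    ∃ s < a, ∀ y, y₀ ≤ y → Function.leftLim (truncRow ℓ x₀ y) a = truncRow ℓ x₀ y s := by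
  obtain ⟨s, hs, hsa⟩ := ((h.eventually_leftLim_eq hxy a).and self_mem_nhdsWithin).exists
  exact ⟨s, hsa, hs⟩

theorem rowJump_anti (h : IsStepSurface ℓ c d) (hxy : x₀ < y₀) (a : ℝ) {y y' : ℝ} (hy : y₀ ≤ y)
    (hyy' : y ≤ y') : rowJump ℓ x₀ a y' ≤ rowJump ℓ x₀ a y := by
  obtain ⟨s, hsa, hs⟩ := h.exists_leftLim_eq hxy a
  have h1 := h.truncRow_rect hsa.le (hxy.trans_le hy) hyy'
  have h2 := h.truncRow_mono (hxy.trans_le hy) hsa.le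
  rw [rowJump, rowJump, hs y hy, hs y' (hy.trans hyy')]
  omega

theorem rowJumpLoss_mono (h : IsStepSurface ℓ c d) (hxy : x₀ < y₀) (a : ℝ) :
    Monotone (rowJumpLoss ℓ x₀ y₀ a) := fun _ _ hyy' =>
  Nat.sub_le_sub_left (h.rowJump_anti hxy a (le_max_right _ _) (max_le_max_right _ hyy')) _

theorem eventually_rowJump_eq (h : IsStepSurface ℓ c d) (hxy : x₀ < y₀) (a : ℝ) {y : ℝ}
    (hy : y₀ ≤ y) : ∀ᶠ y' in 𝓝[>] y, rowJump ℓ x₀ a y' = rowJump ℓ x₀ a y := by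
  obtain ⟨s, hsa, hs⟩ := h.exists_leftLim_eq hxy a
  have hlt : ∀ x, min x x₀ < y := fun x => (min_le_right _ _).trans_lt (hxy.trans_le hy)
  filter_upwards [h.right_snd _ _ (hlt a), h.right_snd _ _ (hlt s), self_mem_nhdsWithin]
    with y' h1 h2 hyy'
  rw [rowJump, rowJump, hs y hy, hs y' (hy.trans (le_of_lt hyy')), truncRow, truncRow, truncRow,
    truncRow, h1, h2]

theorem tsum_rowJump (h : IsStepSurface ℓ c d) (hxy : x₀ < y₀) :
    ∑' a : ℝ, (rowJump ℓ x₀ a y₀ : ℝ≥0∞) = ℓ x₀ y₀ := by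
  refine tsum_jumps_eq (h.truncRow_mono hxy) (fun x => ?_) (c := min c x₀) (d := x₀)
    (fun x hx => ?_) (fun x hx => ?_)
  · rcases lt_or_ge x x₀ with hx | hx
    · filter_upwards [h.right_fst x y₀ (hx.trans hxy), Ioo_mem_nhdsGT hx] with x' hx' hx'x
      rw [truncRow, truncRow, min_eq_left hx.le, min_eq_left hx'x.2.le, hx']
    · filter_upwards [self_mem_nhdsWithin] with x' hx'
      rw [truncRow, truncRow, min_eq_right hx, min_eq_right (hx.trans (le_of_lt hx'))]
  · obtain ⟨hxc, hx₀⟩ := lt_min_iff.1 hx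
    rw [truncRow, min_eq_left hx₀.le]
    exact h.eq_zero _ _ hxc (hx₀.trans hxy)
  · rw [truncRow, min_eq_right hx]

theorem rowJump_eq_of_le (h : IsStepSurface ℓ c d) (hxy : x₀ < y₀) (a : ℝ) {y : ℝ}
    (hy₀ : y₀ ≤ y) (hy : d ≤ y) {y' : ℝ} (hyy' : y ≤ y') :
    rowJump ℓ x₀ a y' = rowJump ℓ x₀ a y := by
  obtain ⟨s, hsa, hs⟩ := h.exists_leftLim_eq hxy a
  have key : ∀ x, truncRow ℓ x₀ y' x = truncRow ℓ x₀ y x := fun x => by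
    rw [truncRow, truncRow, h.eq_top _ _ hy, h.eq_top _ _ (hy.trans hyy')]
  rw [rowJump, rowJump, hs y hy₀, hs y' (hy₀.trans hyy'), key, key]

theorem tsum_rowJumpLoss (h : IsStepSurface ℓ c d) (hxy : x₀ < y₀) (a : ℝ) {y : ℝ}
    (hy₀ : y₀ ≤ y) (hy : d ≤ y) :
    ∑' b : ℝ, ((rowJumpLoss ℓ x₀ y₀ a b - Function.leftLim (rowJumpLoss ℓ x₀ y₀ a) b : ℕ) : ℝ≥0∞)
      + rowJump ℓ x₀ a y = rowJump ℓ x₀ a y₀ := by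
  rw [tsum_jumps_eq (h.rowJumpLoss_mono hxy a) (fun b => ?_)
    (N := rowJump ℓ x₀ a y₀ - rowJump ℓ x₀ a y) (c := y₀) (d := y)
    (fun b hb => ?_) (fun b hb => ?_)]
  · exact_mod_cast Nat.sub_add_cancel (h.rowJump_anti hxy a le_rfl hy₀)
  · rcases lt_or_ge b y₀ with hb | hb
    · filter_upwards [Ioo_mem_nhdsGT hb] with b' hb'
      rw [rowJumpLoss, rowJumpLoss, max_eq_right hb.le, max_eq_right hb'.2.le]
    · filter_upwards [h.eventually_rowJump_eq hxy a hb, self_mem_nhdsWithin] with b' hb' hbb'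
      rw [rowJumpLoss, rowJumpLoss, max_eq_left hb, max_eq_left (hb.trans (le_of_lt hbb')), hb']
  · rw [rowJumpLoss, max_eq_right hb.le, Nat.sub_self]
  · rw [rowJumpLoss, max_eq_left (hy₀.trans hb), h.rowJump_eq_of_le hxy a hy₀ hy hb]

end IsStepSurface

theorem tendsto_sub_nhdsLT (a : ℝ) : Tendsto (fun ε : ℝ => a - ε) (𝓝[>] 0) (𝓝[<] a) := by
  refine tendsto_nhdsWithin_iff.2 ⟨?_, ?_⟩
  · exact ((continuous_const.sub continuous_id).tendsto' 0 a (sub_zero a)).mono_left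
      nhdsWithin_le_nhds
  · filter_upwards [self_mem_nhdsWithin] with ε hε
    exact sub_lt_self a hε

theorem tendsto_add_nhdsGT (a : ℝ) : Tendsto (fun ε : ℝ => a + ε) (𝓝[>] 0) (𝓝[>] a) := by
  refine tendsto_nhdsWithin_iff.2 ⟨?_, ?_⟩
  · exact ((continuous_const.add continuous_id).tendsto' 0 a (add_zero a)).mono_left
      nhdsWithin_le_nhds
  · filter_upwards [self_mem_nhdsWithin] with ε hε
    exact lt_add_of_pos_right a hε

/-- A monotone integer function of a small positive parameter attains its infimum as the
parameter tends to `0`. -/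
theorem sInf_eq_of_eventually_eq {p : ℝ → Prop} {f : ℝ → ℤ} {v : ℤ}
    (hmono : ∀ ε ε', 0 < ε' → ε' ≤ ε → p ε → p ε' → f ε' ≤ f ε)
    (hev : ∀ᶠ ε in 𝓝[>] (0 : ℝ), p ε ∧ f ε = v) :
    sInf {w : ℤ | ∃ ε : ℝ, 0 < ε ∧ p ε ∧ w = f ε} = v := by
  refine IsLeast.csInf_eq ⟨?_, ?_⟩
  · obtain ⟨ε, ⟨hp, hf⟩, hε⟩ := (hev.and self_mem_nhdsWithin).exists
    exact ⟨ε, hε, hp, hf.symm⟩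
  · rintro _ ⟨ε, hε, hp, rfl⟩
    obtain ⟨ε', ⟨hp', hf'⟩, hε'⟩ := (hev.and (Ioo_mem_nhdsGT hε)).exists
    exact hf' ▸ hmono ε ε' hε'.1 hε'.2.le hp hp'

namespace IsStepSurface

theorem eventually_sub_eq_rowJump (h : IsStepSurface ℓ c d) (hxy : x₀ < y₀) {a : ℝ}
    (ha : a ≤ x₀) : ∀ᶠ ε in 𝓝[>] (0 : ℝ), a + ε < y₀ ∧ ∀ y, y₀ ≤ y →
      (ℓ (a + ε) y : ℤ) - ℓ (a - ε) y = rowJump ℓ x₀ a y := by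
  have hay : a < y₀ := ha.trans_lt hxy
  filter_upwards [(tendsto_sub_nhdsLT a).eventually (h.eventually_leftLim_eq hxy a),
    (tendsto_add_nhdsGT a).eventually (h.right_fst a y₀ hay),
    (tendsto_add_nhdsGT a).eventually (Ioo_mem_nhdsGT hay), self_mem_nhdsWithin]
    with ε h1 h2 h3 hε
  have hε' : 0 < ε := hε
  refine ⟨h3.2, fun y hy => ?_⟩
  have h4 := h.eq_of_eq (h3.1.le) h3.2 hy h2
  have h5 := h.truncRow_mono (hxy.trans_le hy) (sub_le_self a hε'.le)
  rw [rowJump, h1 y hy, Nat.cast_sub h5, truncRow, truncRow, min_eq_left ha,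
    min_eq_left ((sub_le_self a hε'.le).trans ha), h4]

theorem mult_eq (h : IsStepSurface ℓ c d) (hxy : x₀ < y₀) {a b : ℝ} (ha : a ≤ x₀) (hb : y₀ < b) :
    mult ℓ a b =
      (rowJumpLoss ℓ x₀ y₀ a b - Function.leftLim (rowJumpLoss ℓ x₀ y₀ a) b : ℕ) := by
  refine sInf_eq_of_eventually_eq (fun ε ε' hε' hle hp hp' => ?_) ?_
  · have r1 := h.rect (a - ε) (a - ε') (b - ε) (b + ε) (by linarith) (by linarith) (by linarith)
    have r2 := h.rect (a + ε') (a + ε) (b - ε) (b + ε) (by linarith) (by linarith) (by linarith)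
    have r3 := h.rect (a - ε') (a + ε') (b - ε) (b - ε') (by linarith) (by linarith) (by linarith)
    have r4 := h.rect (a - ε') (a + ε') (b + ε') (b + ε) (by linarith) (by linarith) (by linarith)
    omega
  · filter_upwards [h.eventually_sub_eq_rowJump hxy ha,
      (tendsto_sub_nhdsLT b).eventually (eventually_eq_leftLim (h.rowJumpLoss_mono hxy a) b),
      (tendsto_sub_nhdsLT b).eventually (Ioo_mem_nhdsLT hb),
      (tendsto_add_nhdsGT b).eventually (h.eventually_rowJump_eq hxy a hb.le),
      self_mem_nhdsWithin] with ε ⟨h1, h2⟩ h3 h4 h5 hε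
    have hε' : 0 < ε := hε
    refine ⟨h1.trans h4.1, ?_⟩
    have e1 := h2 _ h4.1.le
    have e2 := h2 (b + ε) (by linarith)
    have a1 := h.rowJump_anti hxy a le_rfl h4.1.le
    have a2 := h.rowJump_anti hxy a h4.1.le h4.2.le
    rw [← h3, rowJumpLoss, rowJumpLoss, max_eq_left hb.le, max_eq_left h4.1.le]
    omega

theorem multInf_eq (h : IsStepSurface ℓ c d) (hxy : x₀ < y₀) {a y : ℝ} (ha : a ≤ x₀)
    (hy₀ : y₀ ≤ y) (hy : d ≤ y) : multInf ℓ a = rowJump ℓ x₀ a y := by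
  refine sInf_eq_of_eventually_eq (fun ε ε' hε' hle hp hp' => ?_) ?_
  · have hinv : 1 / ε ≤ 1 / ε' := one_div_le_one_div_of_le hε' hle
    have r1 := h.rect (a - ε') (a + ε') (1 / ε) (1 / ε') (by linarith) (by linarith) hinv
    have r2 := h.mono (a - ε) (a - ε') (1 / ε) (by linarith) (by linarith)
    have r3 := h.mono (a + ε') (a + ε) (1 / ε) (by linarith) (by linarith)
    omega
  · filter_upwards [h.eventually_sub_eq_rowJump hxy ha,
      tendsto_inv_nhdsGT_zero.eventually (eventually_ge_atTop y)] with ε ⟨h1, h2⟩ h3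
    rw [← one_div] at h3
    refine ⟨h1.trans_le (hy₀.trans h3), ?_⟩
    rw [h2 _ (hy₀.trans h3), h.rowJump_eq_of_le hxy a hy₀ hy h3]

theorem rowJump_eq_zero (h : IsStepSurface ℓ c d) {a y : ℝ} (hy : x₀ < y) (ha : x₀ < a) :
    rowJump ℓ x₀ a y = 0 := by
  have heq : truncRow ℓ x₀ y a = truncRow ℓ x₀ y x₀ := by
    rw [truncRow, truncRow, min_self, min_eq_right ha.le]
  rw [rowJump, Nat.sub_eq_zero_iff_le, heq]
  exact (h.truncRow_mono hy).le_leftLim ha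

/-- The value of `ℓ` at `(x₀, y₀)` is the sum of the multiplicities of the cornerpoints above and
on the left of `(x₀, y₀)`. -/
theorem eq_tsum_mult (h : IsStepSurface ℓ c d) (hxy : x₀ < y₀) :
    (ℓ x₀ y₀ : ℝ≥0∞) =
      (∑' p : {p : ℝ × ℝ // IsProperCornerpoint ℓ p.1 p.2 ∧ p.1 ≤ x₀ ∧ y₀ < p.2},
        ((mult ℓ p.1.1 p.1.2).toNat : ℝ≥0∞)) +
      ∑' a : {a : ℝ // IsCornerpointAtInfinity ℓ a ∧ a ≤ x₀},
        ((multInf ℓ a.1).toNat : ℝ≥0∞) := by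
  have hproper := tsum_subtype
    {p : ℝ × ℝ | IsProperCornerpoint ℓ p.1 p.2 ∧ p.1 ≤ x₀ ∧ y₀ < p.2}
    (fun p => ((mult ℓ p.1 p.2).toNat : ℝ≥0∞))
  have hinf := tsum_subtype {a : ℝ | IsCornerpointAtInfinity ℓ a ∧ a ≤ x₀}
    (fun a => ((multInf ℓ a).toNat : ℝ≥0∞))
  refine Eq.trans ?_ (congrArg₂ (· + ·) hproper hinf).symm
  rw [ENNReal.tsum_prod', ← ENNReal.tsum_add, ← h.tsum_rowJump hxy]
  refine tsum_congr fun a => ?_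
  rw [← h.tsum_rowJumpLoss hxy a (le_max_left y₀ d) (le_max_right y₀ d)]
  congr 1
  · refine tsum_congr fun b => ?_
    by_cases hab : a ≤ x₀ ∧ y₀ < b
    · have hm := h.mult_eq hxy hab.1 hab.2
      by_cases hp : 0 < mult ℓ a b
      · have hmem : (a, b) ∈ {p : ℝ × ℝ | IsProperCornerpoint ℓ p.1 p.2 ∧ p.1 ≤ x₀ ∧ y₀ < p.2} :=
          ⟨⟨hab.1.trans_lt (hxy.trans hab.2), hp⟩, hab⟩
        rw [Set.indicator_of_mem hmem, hm, Int.toNat_natCast]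
      · rw [Set.indicator_of_notMem fun hmem => hp hmem.1.2]
        exact_mod_cast (by omega : _ = 0)
    · rw [Set.indicator_of_notMem fun hmem => hab hmem.2]
      have hK : rowJumpLoss ℓ x₀ y₀ a b = 0 := by
        rcases le_or_gt a x₀ with ha | ha
        · rw [rowJumpLoss, max_eq_right (not_lt.1 fun hb => hab ⟨ha, hb⟩), Nat.sub_self]
        · rw [rowJumpLoss, h.rowJump_eq_zero hxy ha, Nat.zero_sub]
      rw [hK, Nat.zero_sub, Nat.cast_zero]
  · by_cases ha : a ≤ x₀
    · have hm := h.multInf_eq hxy ha (le_max_left y₀ d) (le_max_right y₀ d)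
      by_cases hp : 0 < multInf ℓ a
      · have hmem : a ∈ {a : ℝ | IsCornerpointAtInfinity ℓ a ∧ a ≤ x₀} := ⟨hp, ha⟩
        rw [Set.indicator_of_mem hmem, hm, Int.toNat_natCast]
      · rw [Set.indicator_of_notMem fun hmem => hp hmem.1]
        exact_mod_cast (by omega : _ = 0)
    · rw [Set.indicator_of_notMem fun hmem => ha hmem.2,
        h.rowJump_eq_zero (hxy.trans_le (le_max_left y₀ d)) (not_le.1 ha), Nat.cast_zero]

end IsStepSurface

end Multiplicities

end Topology

/-- Representation Theorem: `ℓ_{(M,φ)}(xbar, ybar)` equals the number of cornerpoints (proper or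
at infinity), counted with multiplicity, lying above and on the left of `(xbar, ybar)`. -/
theorem representation_theorem {M : Type*} [TopologicalSpace M] [Nonempty M]
    [CompactSpace M] [LocallyConnectedSpace M] [T2Space M]
    (φ : M → ℝ) (hφ : Continuous φ) (xbar ybar : ℝ) (hxy : xbar < ybar) :
    (size1 φ xbar ybar : ℝ≥0∞) =
      (∑' p : {p : ℝ × ℝ // IsProperCornerpoint (size1 φ) p.1 p.2 ∧ p.1 ≤ xbar ∧ ybar < p.2},
        ((mult (size1 φ) p.1.1 p.1.2).toNat : ℝ≥0∞)) +
      ∑' a : {a : ℝ // IsCornerpointAtInfinity (size1 φ) a ∧ a ≤ xbar},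
        ((multInf (size1 φ) a.1).toNat : ℝ≥0∞) := by
  obtain ⟨c, d, h⟩ := isStepSurface_size1 hφ
  exact h.eq_tsum_mult hxy

end SizeTheory
end
end

section
/- (Matching Stability Theorem.) If (M, φ) and (M, ψ) are two size pairs with real-valued measuring functions on the same space M, and max_{P∈M} |φ(P) − ψ(P)| ≤ ε, then d_match(ℓ_{(M,φ)}, ℓ_{(M,ψ)}) ≤ ε. -/
open scoped ENNReal Manifold
open Filter

noncomputable section

namespace SizeTheory

/-! ### Rank functions -/

/-- An abstract rank function: the box inequality on `{s < t}`, and vanishing for very low `s`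
and very high `t`. -/
structure IsRankFunction (L : ℝ → ℝ → ℕ) : Prop where
  box : ∀ {s s' t t' : ℝ}, s ≤ s' → s' < t → t ≤ t' → L s' t' + L s t ≤ L s' t + L s t'
  zero_left : ∃ a, ∀ s t, s ≤ a → s < t → L s t = 0
  zero_right : ∃ a, ∀ s t, a ≤ t → s < t → L s t = 0

/-- The reflection of a rank function across the antidiagonal. -/
def dual (L : ℝ → ℝ → ℕ) (s t : ℝ) : ℕ := L (-t) (-s)

/-- The number of classes of a rank function born exactly at `b` and still alive at `t`. -/
def birthCount (L : ℝ → ℝ → ℕ) (b t : ℝ) : ℕ :=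
  sInf {v : ℕ | ∃ δ : ℝ, 0 < δ ∧ b + δ < t ∧ v = L (b + δ) t - L (b - δ) t}

/-- Among the classes born at `x`, sorted by decreasing death, the `r`-th one dies at `y`. -/
def BirthRank (L : ℝ → ℝ → ℕ) (x y : ℝ) (r : ℕ) : Prop :=
  (∀ t, x < t → t < y → r < birthCount L x t) ∧ ∀ t, y < t → birthCount L x t ≤ r

/-- A bar of `L`: a point `(birth, death)` above the diagonal, together with an index bounded by
its multiplicity. -/
@[ext] structure Bar (L : ℝ → ℝ → ℕ) where
  birth : ℝ
  death : ℝ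
  idx : ℕ
  lt : birth < death
  idx_lt : (idx : ℤ) < mult L birth death

lemma mult_dual (L : ℝ → ℝ → ℕ) (x y : ℝ) : mult (dual L) x y = mult L (-y) (-x) := by
  unfold mult dual
  congr 1
  ext v
  refine exists_congr fun δ => and_congr_right fun _ => and_congr ?_ ?_
  · constructor <;> intro h <;> linarith
  · have e1 : -(y - δ) = -y + δ := by ring
    have e2 : -(x + δ) = -x - δ := by ring
    have e3 : -(y + δ) = -y - δ := by ring
    have e4 : -(x - δ) = -x + δ := by ring
    rw [e1, e2, e3, e4]
    constructor <;> intro h <;> linarith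

/-- The bar of `L` corresponding to a bar of its reflection. -/
def Bar.ofDual {L : ℝ → ℝ → ℕ} (q : Bar (dual L)) : Bar L where
  birth := -q.death
  death := -q.birth
  idx := q.idx
  lt := neg_lt_neg q.lt
  idx_lt := by simpa only [mult_dual] using q.idx_lt

/-- The bar of the reflection of `L` corresponding to a bar of `L`. -/
def Bar.toDual {L : ℝ → ℝ → ℕ} (q : Bar L) : Bar (dual L) where
  birth := -q.death
  death := -q.birth
  idx := q.idx
  lt := neg_lt_neg q.lt
  idx_lt := by simpa only [mult_dual, neg_neg] using q.idx_lt

lemma Bar.toDual_ofDual {L : ℝ → ℝ → ℕ} (q : Bar (dual L)) : q.ofDual.toDual = q := by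
  ext <;> simp [Bar.toDual, Bar.ofDual]

lemma Bar.ofDual_toDual {L : ℝ → ℝ → ℕ} (q : Bar L) : q.toDual.ofDual = q := by
  ext <;> simp [Bar.toDual, Bar.ofDual]

namespace IsRankFunction

variable {L L' : ℝ → ℝ → ℕ}

lemma mono (hL : IsRankFunction L) {s s' t : ℝ} (h : s ≤ s') (h' : s' < t) :
    L s t ≤ L s' t := by
  obtain ⟨a, ha⟩ := hL.zero_right
  have hb := hL.box h h' (le_max_left t a)
  have h1 := ha s (max t a) (le_max_right _ _) (by linarith [le_max_left t a])
  have h2 := ha s' (max t a) (le_max_right _ _) (by linarith [le_max_left t a])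
  omega

lemma anti (hL : IsRankFunction L) {s t t' : ℝ} (h : s < t) (h' : t ≤ t') :
    L s t' ≤ L s t := by
  obtain ⟨a, ha⟩ := hL.zero_left
  have hb := hL.box (min_le_left s a) h h'
  have h1 := ha (min s a) t (min_le_right _ _) (by linarith [min_le_left s a])
  have h2 := ha (min s a) t' (min_le_right _ _) (by linarith [min_le_left s a])
  omega

lemma dual (hL : IsRankFunction L) : IsRankFunction (dual L) where
  box := by
    intro s s' t t' h1 h2 h3
    have := hL.box (neg_le_neg h3) (neg_lt_neg h2) (neg_le_neg h1)
    simp only [SizeTheory.dual]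
    omega
  zero_left := by
    obtain ⟨a, ha⟩ := hL.zero_right
    exact ⟨-a, fun s t h h' => ha _ _ (by linarith) (by linarith)⟩
  zero_right := by
    obtain ⟨a, ha⟩ := hL.zero_left
    exact ⟨-a, fun s t h h' => ha _ _ (by linarith) (by linarith)⟩

lemma exists_eq_birthCount (hL : IsRankFunction L) {b t : ℝ} (h : b < t) :
    ∃ δ₀ > 0, b + δ₀ < t ∧ ∀ δ, 0 < δ → δ ≤ δ₀ → ∀ t', t ≤ t' →
      L (b + δ) t' = birthCount L b t' + L (b - δ) t' := by
  have hne : {v : ℕ | ∃ δ : ℝ, 0 < δ ∧ b + δ < t ∧ v = L (b + δ) t - L (b - δ) t}.Nonempty :=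
    ⟨_, (t - b) / 2, by linarith, by linarith, rfl⟩
  obtain ⟨δ₀, h0, hlt, heq⟩ := Nat.sInf_mem hne
  refine ⟨δ₀, h0, hlt, fun δ hδ hδ₀ t' ht' => ?_⟩
  have hmem : birthCount L b t' ∈ {v : ℕ | ∃ δ : ℝ, 0 < δ ∧ b + δ < t' ∧
      v = L (b + δ) t' - L (b - δ) t'} :=
    Nat.sInf_mem ⟨_, δ, hδ, by linarith, rfl⟩
  obtain ⟨δ₁, h1, hlt1, heq1⟩ := hmem
  have hle : birthCount L b t' ≤ L (b + δ) t' - L (b - δ) t' :=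
    Nat.sInf_le ⟨δ, hδ, by linarith, rfl⟩
  have hm := hL.mono (s := b - δ) (s' := b + δ) (t := t') (by linarith) (by linarith)
  rcases le_total δ δ₁ with hc | hc
  · have a1 := hL.mono (s := b + δ) (s' := b + δ₁) (t := t') (by linarith) (by linarith)
    have a2 := hL.mono (s := b - δ₁) (s' := b - δ) (t := t') (by linarith) (by linarith)
    omega
  · have a1 := hL.box (s := b + δ₁) (s' := b + δ₀) (by linarith) hlt ht'
    have a2 := hL.box (s := b - δ₀) (s' := b - δ₁) (t := t) (by linarith) (by linarith) ht'
    have a3 : sInf {v : ℕ | ∃ δ : ℝ, 0 < δ ∧ b + δ < t ∧ v = L (b + δ) t - L (b - δ) t}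
      ≤ L (b + δ₁) t - L (b - δ₁) t := Nat.sInf_le ⟨δ₁, h1, by linarith, rfl⟩
    have a4 := hL.mono (s := b + δ) (s' := b + δ₀) (t := t') (by linarith) (by linarith)
    have a5 := hL.mono (s := b - δ₀) (s' := b - δ) (t := t') (by linarith) (by linarith)
    have a6 := hL.mono (s := b - δ₁) (s' := b + δ₁) (t := t) (by linarith) (by linarith)
    have a7 := hL.mono (s := b - δ₀) (s' := b + δ₀) (t := t) (by linarith) (by linarith)
    have a8 := hL.mono (s := b - δ₁) (s' := b + δ₁) (t := t') (by linarith) (by linarith)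
    omega

lemma birthCount_anti (hL : IsRankFunction L) {b t t' : ℝ} (h : b < t) (h' : t ≤ t') :
    birthCount L b t' ≤ birthCount L b t := by
  obtain ⟨δ, h0, hlt, H⟩ := hL.exists_eq_birthCount h
  have h1 := H δ h0 le_rfl t le_rfl
  have h2 := H δ h0 le_rfl t' h'
  have h3 := hL.box (s := b - δ) (s' := b + δ) (by linarith) hlt h'
  omega

/-- Comparison of birth counts from comparison of increments. -/
lemma birthCount_le (hL : IsRankFunction L) (hL' : IsRankFunction L') {c : ℝ} (hc : 0 ≤ c)
    (H : ∀ s s' t, s ≤ s' → s' < t → L' s' (t + c) + L s t ≤ L s' t + L' s (t + c))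
    {b t : ℝ} (h : b < t) : birthCount L' b (t + c) ≤ birthCount L b t := by
  obtain ⟨δ, h0, hlt, K⟩ := hL.exists_eq_birthCount h
  obtain ⟨δ', h0', hlt', K'⟩ := hL'.exists_eq_birthCount (show b < t + c by linarith)
  have h1 := K (min δ δ') (lt_min h0 h0') (min_le_left _ _) t le_rfl
  have h2 := K' (min δ δ') (lt_min h0 h0') (min_le_right _ _) (t + c) le_rfl
  have hm : 0 < min δ δ' := lt_min h0 h0'
  have h3 := H (b - min δ δ') (b + min δ δ') t (by linarith)
    (by linarith [min_le_left δ δ'])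
  omega

lemma value_mono (hL : IsRankFunction L) {x y δ δ' : ℝ} (h0 : 0 < δ') (h : δ' ≤ δ)
    (hxy : x + δ < y - δ) :
    (L (x + δ') (y - δ') : ℤ) - L (x - δ') (y - δ') - L (x + δ') (y + δ') + L (x - δ') (y + δ')
    ≤ L (x + δ) (y - δ) - L (x - δ) (y - δ) - L (x + δ) (y + δ) + L (x - δ) (y + δ) := by
  have a1 := hL.box (s := x - δ) (s' := x + δ) (t := y - δ) (t' := y - δ')
    (by linarith) (by linarith) (by linarith)
  have a2 := hL.box (s := x - δ) (s' := x + δ) (t := y + δ') (t' := y + δ)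
    (by linarith) (by linarith) (by linarith)
  have a3 := hL.box (s := x - δ) (s' := x - δ') (t := y - δ') (t' := y + δ')
    (by linarith) (by linarith) (by linarith)
  have a4 := hL.box (s := x + δ') (s' := x + δ) (t := y - δ') (t' := y + δ')
    (by linarith) (by linarith) (by linarith)
  omega

lemma exists_birthRank_iff (hL : IsRankFunction L) {x y : ℝ} (hxy : x < y) :
    ∃ k m : ℕ, mult L x y = m ∧ ∀ r, BirthRank L x y r ↔ k ≤ r ∧ r < k + m := by
  obtain ⟨t₀, ⟨hx0, h0y⟩, hmin⟩ : ∃ t₀ ∈ Set.Ioo x y, ∀ t ∈ Set.Ioo x y,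
      birthCount L x t₀ ≤ birthCount L x t := by
    have hne : (birthCount L x '' Set.Ioo x y).Nonempty := (Set.nonempty_Ioo.2 hxy).image _
    obtain ⟨t₀, ht₀, e⟩ := Nat.sInf_mem hne
    exact ⟨t₀, ht₀, fun t ht => e ▸ Nat.sInf_le ⟨t, ht, rfl⟩⟩
  obtain ⟨t₁, h1y, hmax⟩ : ∃ t₁ > y, ∀ t > y, birthCount L x t ≤ birthCount L x t₁ := by
    have hne : (birthCount L x '' Set.Ioi y).Nonempty := Set.nonempty_Ioi.image _
    have hb : BddAbove (birthCount L x '' Set.Ioi y) := by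
      refine ⟨birthCount L x y, ?_⟩
      rintro _ ⟨t, ht, rfl⟩
      exact hL.birthCount_anti hxy (le_of_lt ht)
    obtain ⟨t₁, ht₁, e⟩ := Nat.sSup_mem hne hb
    exact ⟨t₁, ht₁, fun t ht => e ▸ le_csSup hb ⟨t, ht, rfl⟩⟩
  have hle : birthCount L x t₁ ≤ birthCount L x t₀ := hL.birthCount_anti hx0 (by linarith)
  refine ⟨birthCount L x t₁, birthCount L x t₀ - birthCount L x t₁, ?_, ?_⟩
  · apply le_antisymm
    · obtain ⟨δ₀, hδ₀, hlt, H⟩ := hL.exists_eq_birthCount hx0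
      set δ := min (min δ₀ (y - t₀)) (min (t₁ - y) ((y - x) / 4)) with hδ
      have d0 : 0 < δ := by
        refine lt_min (lt_min hδ₀ ?_) (lt_min ?_ ?_) <;> linarith
      have d1 : δ ≤ δ₀ := (min_le_left _ _).trans (min_le_left _ _)
      have d2 : δ ≤ y - t₀ := (min_le_left _ _).trans (min_le_right _ _)
      have d3 : δ ≤ t₁ - y := (min_le_right _ _).trans (min_le_left _ _)
      have d4 : δ ≤ (y - x) / 4 := (min_le_right _ _).trans (min_le_right _ _)
      have e1 := H δ d0 d1 (y - δ) (by linarith)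
      have e2 := H δ d0 d1 (y + δ) (by linarith)
      have e3 := hL.birthCount_anti hx0 (show t₀ ≤ y - δ by linarith)
      have e4 := hL.birthCount_anti (show x < y + δ by linarith) (show y + δ ≤ t₁ by linarith)
      have e5 : mult L x y ≤ (L (x + δ) (y - δ) : ℤ) - L (x - δ) (y - δ)
          - L (x + δ) (y + δ) + L (x - δ) (y + δ) := by
        refine csInf_le ⟨0, ?_⟩ ⟨δ, d0, by linarith, rfl⟩
        rintro v ⟨η, hη, hη', rfl⟩
        have := hL.box (s := x - η) (s' := x + η) (t := y - η) (t' := y + η)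
          (by linarith) hη' (by linarith)
        omega
      omega
    · refine le_csInf ⟨_, (y - x) / 4, by linarith, by linarith, rfl⟩ ?_
      rintro v ⟨δ, hδ, hlt, rfl⟩
      obtain ⟨δ₀, hδ₀, hlt₀, H⟩ := hL.exists_eq_birthCount (show x < y - δ by linarith)
      have d0 : 0 < min δ δ₀ := lt_min hδ hδ₀
      have v1 := hL.value_mono d0 (min_le_left _ _) hlt
      have m1 := min_le_left δ δ₀
      have e1 := H _ d0 (min_le_right _ _) (y - min δ δ₀) (by linarith)
      have e2 := H _ d0 (min_le_right _ _) (y + min δ δ₀) (by linarith)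
      have e3 := hmin (y - min δ δ₀) ⟨by linarith, by linarith⟩
      have e4 := hmax (y + min δ δ₀) (by linarith)
      omega
  · intro r
    constructor
    · rintro ⟨h1, h2⟩
      have := h1 t₀ hx0 h0y
      have := h2 t₁ h1y
      omega
    · rintro ⟨h1, h2⟩
      refine ⟨fun t hxt hty => ?_, fun t ht => ?_⟩
      · have := hmin t ⟨hxt, hty⟩
        omega
      · have := hmax t ht
        omega

lemma exists_birthRank (hL : IsRankFunction L) {x t : ℝ} {r : ℕ} (hx : x < t)
    (hr : r < birthCount L x t) : ∃ y, t ≤ y ∧ BirthRank L x y r := by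
  have hb : BddAbove {t | x < t ∧ r < birthCount L x t} := by
    obtain ⟨a, ha⟩ := hL.zero_right
    refine ⟨a, fun u hu => ?_⟩
    by_contra! hau
    obtain ⟨δ, h0, hlt, H⟩ := hL.exists_eq_birthCount hu.1
    have h1 := H δ h0 le_rfl u le_rfl
    have h2 := ha (x + δ) u hau.le hlt
    have h3 := hu.2
    omega
  refine ⟨sSup {t | x < t ∧ r < birthCount L x t}, le_csSup hb ⟨hx, hr⟩, ?_, ?_⟩
  · intro u hxu hu
    have hne : {t | x < t ∧ r < birthCount L x t}.Nonempty := ⟨t, hx, hr⟩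
    obtain ⟨w, ⟨hw1, hw2⟩, huw⟩ := exists_lt_of_lt_csSup hne hu
    exact hw2.trans_le (hL.birthCount_anti hxu huw.le)
  · intro u hu
    by_contra! hc
    have hxu : x < u := hx.trans_le ((le_csSup hb ⟨hx, hr⟩).trans hu.le)
    have hmem : u ∈ {t | x < t ∧ r < birthCount L x t} := ⟨hxu, hc⟩
    exact absurd (le_csSup hb hmem) (not_le.2 hu)

lemma exists_rank (hL : IsRankFunction L) : ∃ ρ : Bar L → ℕ,
    (∀ q, BirthRank L q.birth q.death (ρ q)) ∧
    (∀ q q', q.birth = q'.birth → ρ q = ρ q' → q = q') ∧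
    ∀ x y r, x < y → BirthRank L x y r → ∃ q : Bar L, q.birth = x ∧ q.death = y ∧ ρ q = r := by
  have H : ∀ x y, ∃ k m : ℕ, x < y →
      mult L x y = m ∧ ∀ r, BirthRank L x y r ↔ k ≤ r ∧ r < k + m := by
    intro x y
    by_cases hxy : x < y
    · obtain ⟨k, m, h⟩ := hL.exists_birthRank_iff hxy
      exact ⟨k, m, fun _ => h⟩
    · exact ⟨0, 0, fun h => absurd h hxy⟩
  choose k m hkm using H
  have key : ∀ q : Bar L, BirthRank L q.birth q.death (k q.birth q.death + q.idx) := by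
    intro q
    obtain ⟨h1, h2⟩ := hkm _ _ q.lt
    have := q.idx_lt
    exact (h2 _).2 ⟨by omega, by omega⟩
  refine ⟨fun q => k q.birth q.death + q.idx, key, ?_, ?_⟩
  · intro q q' hb hr
    have hd : q.death = q'.death := by
      have h1 := key q
      have h2 := key q'
      simp only at hr
      rw [hr, hb] at h1
      rcases lt_trichotomy q.death q'.death with hlt | heq | hlt
      · obtain ⟨u, hu1, hu2⟩ := exists_between hlt
        exact absurd (h2.1 u (by linarith [q.lt]) hu2) (not_lt.2 (h1.2 u hu1))
      · exact heq
      · obtain ⟨u, hu1, hu2⟩ := exists_between hlt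
        exact absurd (h1.1 u (by linarith [q'.lt]) hu2) (not_lt.2 (h2.2 u hu1))
    simp only [hb, hd] at hr
    exact Bar.ext hb hd (by omega)
  · intro x y r hxy hr
    obtain ⟨h1, h2⟩ := hkm _ _ hxy
    obtain ⟨h3, h4⟩ := (h2 r).1 hr
    refine ⟨⟨x, y, r - k x y, hxy, by omega⟩, rfl, rfl, ?_⟩
    simp only
    omega

/-- Matching of the bars with a common birth. -/
theorem birth_matching (hL : IsRankFunction L) (hL' : IsRankFunction L') {c : ℝ} (hc : 0 ≤ c)
    (H : ∀ s s' t, s ≤ s' → s' < t → L' s' t + L s t ≤ L s' t + L' s t)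
    (H' : ∀ s s' t, s ≤ s' → s' < t → L s' (t + c) + L' s t ≤ L' s' t + L s (t + c)) :
    ∃ f : Bar L' → Bar L, Function.Injective f ∧
      (∀ p, (f p).birth = p.birth ∧ p.death ≤ (f p).death ∧ (f p).death ≤ p.death + c) ∧
      ∀ q : Bar L, q.birth + c < q.death → q ∈ Set.range f := by
  obtain ⟨ρ, h1, h2, h3⟩ := hL.exists_rank
  obtain ⟨ρ', h1', h2', h3'⟩ := hL'.exists_rank
  have K : ∀ b t, b < t → birthCount L' b t ≤ birthCount L b t := by
    intro b t hbt
    have := hL.birthCount_le hL' le_rfl (by simpa using H) hbt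
    simpa using this
  have K' : ∀ b t, b < t → birthCount L b (t + c) ≤ birthCount L' b t :=
    fun b t hbt => hL'.birthCount_le hL hc H' hbt
  have ex : ∀ p : Bar L', ∃ q : Bar L, q.birth = p.birth ∧ ρ q = ρ' p ∧
      p.death ≤ q.death ∧ q.death ≤ p.death + c := by
    intro p
    obtain ⟨u, hu1, hu2⟩ := exists_between p.lt
    obtain ⟨y, hy, hr⟩ := hL.exists_birthRank hu1
      (((h1' p).1 u hu1 hu2).trans_le (K _ _ hu1))
    obtain ⟨q, hq1, hq2, hq3⟩ := h3 _ _ _ (hu1.trans_le hy) hr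
    refine ⟨q, hq1, hq3, ?_, ?_⟩
    · by_contra! hlt
      rw [hq2] at hlt
      obtain ⟨w, hw1, hw2⟩ := exists_between hlt
      have hpw : p.birth < w := by linarith
      have a1 := (h1' p).1 w hpw hw2
      have a2 := hr.2 w hw1
      have a3 := K _ _ hpw
      omega
    · by_contra! hlt
      rw [hq2] at hlt
      obtain ⟨w, hw1, hw2⟩ := exists_between (show p.death < y - c by linarith)
      have hpw : p.birth < w := by linarith [p.lt]
      have a1 := (h1' p).2 w hw1
      have a2 := hr.1 (w + c) (by linarith) (by linarith)
      have a3 := K' _ _ hpw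
      omega
  choose f hf using ex
  refine ⟨f, ?_, fun p => ⟨(hf p).1, (hf p).2.2⟩, ?_⟩
  · intro p p' hpp
    refine h2' p p' ?_ ?_
    · rw [← (hf p).1, ← (hf p').1, hpp]
    · rw [← (hf p).2.1, ← (hf p').2.1, hpp]
  · intro q hq
    obtain ⟨u, hu1, hu2⟩ := exists_between (show q.birth < q.death - c by linarith)
    obtain ⟨y, hy, hr⟩ := hL'.exists_birthRank hu1
      (((h1 q).1 (u + c) (by linarith) (by linarith)).trans_le (K' _ _ hu1))
    obtain ⟨p, hp1, hp2, hp3⟩ := h3' _ _ _ (hu1.trans_le hy) hr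
    exact ⟨p, h2 _ _ ((hf p).1.trans hp1) ((hf p).2.1.trans hp3)⟩

/-- Matching of the bars with a common death. -/
theorem death_matching (hL : IsRankFunction L) (hL' : IsRankFunction L') {c : ℝ} (hc : 0 ≤ c)
    (H : ∀ s t t', s < t → t ≤ t' → L' s t + L s t' ≤ L s t + L' s t')
    (H' : ∀ s t t', s < t → t ≤ t' → L (s - c) t + L' s t' ≤ L' s t + L (s - c) t') :
    ∃ f : Bar L' → Bar L, Function.Injective f ∧
      (∀ p, (f p).death = p.death ∧ (f p).birth ≤ p.birth ∧ p.birth ≤ (f p).birth + c) ∧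
      ∀ q : Bar L, q.birth + c < q.death → q ∈ Set.range f := by
  obtain ⟨f, hf, hp, hq⟩ := hL.dual.birth_matching hL'.dual hc
    (by
      intro s s' t h1 h2
      have := H (-t) (-s') (-s) (by linarith) (by linarith)
      simpa only [SizeTheory.dual] using this)
    (by
      intro s s' t h1 h2
      have := H' (-t) (-s') (-s) (by linarith) (by linarith)
      have e : -(t + c) = -t - c := by ring
      simp only [SizeTheory.dual, e]
      exact this)
  refine ⟨fun p => (f p.toDual).ofDual, ?_, ?_, ?_⟩
  · intro p p' h
    have h1 := congrArg Bar.toDual h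
    simp only [Bar.toDual_ofDual] at h1
    have h2 := congrArg Bar.ofDual (hf h1)
    simpa only [Bar.ofDual_toDual] using h2
  · intro p
    obtain ⟨h1, h2, h3⟩ := hp p.toDual
    simp only [Bar.ofDual, Bar.toDual] at *
    refine ⟨?_, ?_, ?_⟩ <;> linarith
  · intro q hlt
    obtain ⟨p, hpq⟩ := hq q.toDual (by simp only [Bar.toDual]; linarith)
    exact ⟨p.ofDual, by simp only [Bar.toDual_ofDual, hpq, Bar.ofDual_toDual]⟩

end IsRankFunction

/-! ### Counting components -/

/-- The number of connected components of `B` containing at least one point of `A`. -/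
def compCount {M : Type*} [TopologicalSpace M] (A B : Set M) : ℕ :=
  (connectedComponentIn B '' A).ncard

section Components

variable {M : Type*} [TopologicalSpace M]

lemma size1_eq_compCount (φ : M → ℝ) (s t : ℝ) :
    size1 φ s t = compCount {P | φ P ≤ s} {P | φ P ≤ t} := by
  unfold size1 compCount
  congr 1
  ext S
  exact exists_congr fun P => and_congr_right fun _ => eq_comm

/-- The box inequality for component counts. -/
lemma compCount_box {A A' B B' : Set M} (hA : A ⊆ A') (hAB : A' ⊆ B) (hB : B ⊆ B')
    (hfin : (connectedComponentIn B '' A').Finite) :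
    compCount A' B' + compCount A B ≤ compCount A' B + compCount A B' := by
  have hfac : ∀ P ∈ B, ∀ Q ∈ B, connectedComponentIn B P = connectedComponentIn B Q →
      connectedComponentIn B' P = connectedComponentIn B' Q := by
    intro P hP Q _ h
    have hPQ : P ∈ connectedComponentIn B Q := h ▸ mem_connectedComponentIn hP
    exact (connectedComponentIn_eq (connectedComponentIn_mono Q hB hPQ)).symm
  set C := connectedComponentIn B '' A' with hC
  set C₀ := connectedComponentIn B '' A with hC₀
  have hsub : C₀ ⊆ C := Set.image_mono hA
  have hex : ∀ S : Set M, ∃ S' : Set M,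
      ∀ P ∈ B, connectedComponentIn B P = S → S' = connectedComponentIn B' P := by
    intro S
    by_cases h : ∃ P ∈ B, connectedComponentIn B P = S
    · obtain ⟨P, hP, rfl⟩ := h
      exact ⟨_, fun Q hQ e => hfac P hP Q hQ e.symm⟩
    · exact ⟨∅, fun P hP e => absurd ⟨P, hP, e⟩ h⟩
  choose π hπ using hex
  have himg : ∀ X ⊆ B, connectedComponentIn B' '' X = π '' (connectedComponentIn B '' X) := by
    intro X hX
    rw [Set.image_image]
    exact Set.image_congr fun P hP => (hπ _ P (hX hP) rfl).symm
  unfold compCount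
  rw [himg A' hAB, himg A (hA.trans hAB), ← hC, ← hC₀]
  have hC₀fin := hfin.subset hsub
  have e1 : (C \ C₀).ncard + C₀.ncard = C.ncard := Set.ncard_sdiff_add_ncard_of_subset hsub hfin
  have e2 : (π '' C).ncard ≤ (π '' C₀).ncard + (C \ C₀).ncard := by
    calc (π '' C).ncard ≤ (π '' C₀ ∪ π '' (C \ C₀)).ncard := by
          rw [← Set.image_union, Set.union_sdiff_cancel hsub]
      _ ≤ (π '' C₀).ncard + (π '' (C \ C₀)).ncard := Set.ncard_union_le _ _
      _ ≤ _ := by exact Nat.add_le_add_left (Set.ncard_image_le (hfin.subset Set.sdiff_subset)) _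
  omega

lemma finite_components [LocallyConnectedSpace M] {K U B : Set M}
    (hK : IsCompact K) (hU : IsOpen U) (hKU : K ⊆ U) (hUB : U ⊆ B) :
    (connectedComponentIn B '' K).Finite := by
  obtain ⟨F, hF⟩ := hK.elim_finite_subcover (fun P : U => connectedComponentIn U (P : M))
    (fun P => hU.connectedComponentIn)
    (fun P hP => Set.mem_iUnion.2 ⟨⟨P, hKU hP⟩, mem_connectedComponentIn (hKU hP)⟩)
  refine ((F.finite_toSet.image fun P : U => connectedComponentIn B (P : M))).subset ?_
  rintro _ ⟨P, hP, rfl⟩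
  obtain ⟨Q, hQ, hPQ⟩ := Set.mem_iUnion₂.1 (hF hP)
  exact ⟨Q, hQ, connectedComponentIn_eq (connectedComponentIn_mono _ hUB hPQ)⟩

/-- The size function mixing two measuring functions: births are governed by `φ` and deaths
by `ψ`. -/
def mixedSize (φ ψ : M → ℝ) (s t : ℝ) : ℕ := compCount {P | φ P ≤ s} {P | ψ P ≤ t}

lemma size1_eq_mixedSize (φ : M → ℝ) : size1 φ = mixedSize φ φ := by
  ext s t
  exact size1_eq_compCount φ s t

lemma finite_mixed_components [CompactSpace M] [LocallyConnectedSpace M] {φ ψ : M → ℝ}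
    (hφ : Continuous φ) {s t : ℝ} (hst : s < t) (hle : ∀ P, ψ P ≤ φ P) :
    (connectedComponentIn {P | ψ P ≤ t} '' {P | φ P ≤ s}).Finite :=
  finite_components (U := {P | φ P < t}) (isClosed_le hφ continuous_const).isCompact
    (isOpen_lt hφ continuous_const) (fun P (hP : φ P ≤ s) => hP.trans_lt hst)
    (fun P (hP : φ P < t) => (hle P).trans hP.le)

lemma mixedSize_box [CompactSpace M] [LocallyConnectedSpace M] {φ₁ φ₂ ψ₁ ψ₂ : M → ℝ}
    (hφ₂ : Continuous φ₂) {s₁ s₂ t₁ t₂ : ℝ}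
    (hs : ∀ P, φ₁ P ≤ s₁ → φ₂ P ≤ s₂) (hst : s₂ < t₁) (hφψ : ∀ P, ψ₁ P ≤ φ₂ P)
    (ht : ∀ P, ψ₁ P ≤ t₁ → ψ₂ P ≤ t₂) :
    mixedSize φ₂ ψ₂ s₂ t₂ + mixedSize φ₁ ψ₁ s₁ t₁
      ≤ mixedSize φ₂ ψ₁ s₂ t₁ + mixedSize φ₁ ψ₂ s₁ t₂ := by
  exact compCount_box (fun P hP => hs P hP)
    (fun P (hP : φ₂ P ≤ s₂) => ((hφψ P).trans hP).trans hst.le) (fun P hP => ht P hP)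
    (finite_mixed_components hφ₂ hst hφψ)

lemma mixedSize_le [CompactSpace M] [LocallyConnectedSpace M] {φ₁ φ₂ ψ : M → ℝ}
    (hφ₂ : Continuous φ₂) {s₁ s₂ t : ℝ} (hs : ∀ P, φ₁ P ≤ s₁ → φ₂ P ≤ s₂) (hst : s₂ < t)
    (hφψ : ∀ P, ψ P ≤ φ₂ P) : mixedSize φ₁ ψ s₁ t ≤ mixedSize φ₂ ψ s₂ t :=
  Set.ncard_le_ncard (Set.image_mono fun P hP => hs P hP)
    (finite_mixed_components hφ₂ hst hφψ)

end Components

/-! ### Size functions as truncated rank functions -/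

/-- The properties of size functions used below; `R` bounds the absolute value of the measuring
functions. -/
structure IsSizeFunction (L : ℝ → ℝ → ℕ) (R : ℝ) : Prop where
  box : ∀ {s s' t t' : ℝ}, s ≤ s' → s' < t → t ≤ t' → L s' t' + L s t ≤ L s' t + L s t'
  mono : ∀ {s s' t : ℝ}, s ≤ s' → s' < t → L s t ≤ L s' t
  const_left : ∀ {s s' t : ℝ}, R ≤ s → R ≤ s' → s < t → s' < t → L s t = L s' t
  const_right : ∀ {s t t' : ℝ}, R ≤ t → R ≤ t' → s < t → s < t' → L s t = L s t'
  zero_left : ∀ {s t : ℝ}, s < -R → s < t → L s t = 0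

/-- Truncation of a size function: every class is killed at time `T`. -/
def trunc (T : ℝ) (L : ℝ → ℝ → ℕ) (s t : ℝ) : ℕ := if t < T then L s t else 0

lemma isSizeFunction_mixedSize {M : Type*} [TopologicalSpace M] [CompactSpace M]
    [LocallyConnectedSpace M] {φ ψ : M → ℝ} (hφ : Continuous φ) (hle : ∀ P, ψ P ≤ φ P) {R : ℝ}
    (hφR : ∀ P, |φ P| ≤ R) (hψR : ∀ P, |ψ P| ≤ R) : IsSizeFunction (mixedSize φ ψ) R where
  box h1 h2 h3 := mixedSize_box hφ (fun P h => h.trans h1) h2 hle (fun P h => h.trans h3)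
  mono h1 h2 := mixedSize_le hφ (fun P h => h.trans h1) h2 hle
  zero_left {s t} h1 h2 := by
    have : {P | φ P ≤ s} = ∅ := by
      ext P
      simp only [Set.mem_ofPred_eq, Set.mem_empty_iff_false, iff_false, not_le]
      linarith [(abs_le.1 (hφR P)).1]
    simp [mixedSize, compCount, this]
  const_left {s s' t} h1 h2 _ _ := by
    have : ∀ u, R ≤ u → {P | φ P ≤ u} = Set.univ := fun u hu =>
      Set.eq_univ_of_forall fun P => ((le_abs_self _).trans (hφR P)).trans hu
    simp only [mixedSize, this s h1, this s' h2]
  const_right {s t t'} h1 h2 _ _ := by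
    have : ∀ u, R ≤ u → {P | ψ P ≤ u} = Set.univ := fun u hu =>
      Set.eq_univ_of_forall fun P => ((le_abs_self _).trans (hψR P)).trans hu
    simp only [mixedSize, this t h1, this t' h2]

namespace IsSizeFunction

variable {L : ℝ → ℝ → ℕ} {R T : ℝ}

lemma trunc (hL : IsSizeFunction L R) (T : ℝ) : IsRankFunction (trunc T L) where
  box {s s' t t'} h1 h2 h3 := by
    have a1 := hL.box h1 h2 h3
    have a2 := hL.mono h1 h2
    unfold SizeTheory.trunc
    split_ifs <;> first | omega | linarith
  zero_left := by
    refine ⟨-R - 1, fun s t h h' => ?_⟩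
    unfold SizeTheory.trunc
    rw [hL.zero_left (by linarith) h', ite_self]
  zero_right := ⟨T, fun s t h _ => if_neg (not_lt.2 h)⟩

lemma mult_le (hL : IsSizeFunction L R) {x y δ : ℝ} (h0 : 0 < δ) (h : x + δ < y - δ) :
    mult L x y ≤ (L (x + δ) (y - δ) : ℤ) - L (x - δ) (y - δ)
          - L (x + δ) (y + δ) + L (x - δ) (y + δ) := by
  refine csInf_le ⟨0, ?_⟩ ⟨δ, h0, h, rfl⟩
  rintro v ⟨η, hη, hη', rfl⟩
  have := hL.box (s := x - η) (s' := x + η) (t := y - η) (t' := y + η)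
    (by linarith) hη' (by linarith)
  omega

lemma multInf_le (hL : IsSizeFunction L R) {a δ : ℝ} (h0 : 0 < δ) (h : a + δ < 1 / δ) :
    multInf L a ≤ (L (a + δ) (1 / δ) : ℤ) - L (a - δ) (1 / δ) := by
  refine csInf_le ⟨0, ?_⟩ ⟨δ, h0, h, rfl⟩
  rintro v ⟨η, hη, hη', rfl⟩
  have := hL.mono (s := a - η) (s' := a + η) (t := 1 / η) (by linarith) hη'
  omega

/-- Proper cornerpoints have ordinate at most `R`. -/
lemma mult_nonpos (hL : IsSizeFunction L R) {x y : ℝ} (hxy : x < y) (hy : R < y) :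
    mult L x y ≤ 0 := by
  set δ := min ((y - R) / 2) ((y - x) / 4) with hδ
  have d0 : 0 < δ := lt_min (by linarith) (by linarith)
  have d1 : δ ≤ (y - R) / 2 := min_le_left _ _
  have d2 : δ ≤ (y - x) / 4 := min_le_right _ _
  have h1 := hL.mult_le d0 (show x + δ < y - δ by linarith)
  have h2 := hL.const_right (s := x + δ) (t := y - δ) (t' := y + δ) (by linarith) (by linarith)
    (by linarith) (by linarith)
  have h3 := hL.const_right (s := x - δ) (t := y - δ) (t' := y + δ) (by linarith) (by linarith)
    (by linarith) (by linarith)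
  omega

lemma exists_small (a : ℝ) {η : ℝ} (hη : 0 < η) (N : ℝ) :
    ∃ δ, 0 < δ ∧ δ ≤ η ∧ a + δ < 1 / δ ∧ N ≤ 1 / δ := by
  set m := |a| + η + |N| + 1 with hm
  have hm0 : 0 < m := by positivity
  refine ⟨min η (1 / m), lt_min hη (by positivity), min_le_left _ _, ?_, ?_⟩
  all_goals
    have h1 : m ≤ 1 / min η (1 / m) := by
      rw [le_one_div hm0 (lt_min hη (by positivity))]
      exact min_le_right _ _
    have h2 := min_le_left η (1 / m)
    linarith [le_abs_self a, le_abs_self N, abs_nonneg a, abs_nonneg N]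

/-- Cornerpoints at infinity have abscissa at most `R`. -/
lemma multInf_nonpos (hL : IsSizeFunction L R) {a : ℝ} (ha : R < a) : multInf L a ≤ 0 := by
  obtain ⟨δ, d0, d1, d2, -⟩ := exists_small a (sub_pos.2 ha) 0
  have h1 := hL.multInf_le d0 d2
  have h2 := hL.const_left (s := a + δ) (s' := a - δ) (t := 1 / δ) (by linarith) (by linarith)
    d2 (by linarith)
  omega

lemma mult_trunc_eq (hL : IsSizeFunction L R) {x y : ℝ} (hy : y < T) :
    mult (SizeTheory.trunc T L) x y = mult L x y := by
  have key : ∀ δ, 0 < δ → x + δ < y - δ → ∃ δ', 0 < δ' ∧ δ' ≤ δ ∧ x + δ' < y - δ' ∧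
      ∀ s, SizeTheory.trunc T L s (y - δ') = L s (y - δ') ∧
        SizeTheory.trunc T L s (y + δ') = L s (y + δ') := by
    intro δ h0 h1
    have m1 := min_le_left δ ((T - y) / 2)
    have m2 := min_le_right δ ((T - y) / 2)
    have m0 : 0 < min δ ((T - y) / 2) := lt_min h0 (by linarith)
    exact ⟨_, m0, m1, by linarith,
      fun s => ⟨if_pos (by linarith), if_pos (by linarith)⟩⟩
  have hL0 := hL.trunc T
  unfold mult
  apply csInf_eq_csInf_of_forall_exists_le
  · rintro v ⟨δ, h0, h1, rfl⟩
    obtain ⟨δ', h0', h2, h3, h4⟩ := key δ h0 h1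
    refine ⟨_, ⟨δ', h0', h3, rfl⟩, ?_⟩
    have := hL0.value_mono h0' h2 h1
    simpa only [(h4 _).1, (h4 _).2] using this
  · rintro v ⟨δ, h0, h1, rfl⟩
    obtain ⟨δ', h0', h2, h3, h4⟩ := key δ h0 h1
    refine ⟨_, ⟨δ', h0', h3, rfl⟩, ?_⟩
    simp only [(h4 _).1, (h4 _).2]
    have a1 := hL.box (s := x - δ) (s' := x + δ) (t := y - δ) (t' := y - δ')
      (by linarith) (by linarith) (by linarith)
    have a2 := hL.box (s := x - δ) (s' := x + δ) (t := y + δ') (t' := y + δ)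
      (by linarith) (by linarith) (by linarith)
    have a3 := hL.box (s := x - δ) (s' := x - δ') (t := y - δ') (t' := y + δ')
      (by linarith) (by linarith) (by linarith)
    have a4 := hL.box (s := x + δ') (s' := x + δ) (t := y - δ') (t' := y + δ')
      (by linarith) (by linarith) (by linarith)
    omega

/-- Cornerpoints at infinity become cornerpoints with ordinate `T` after truncation. -/
lemma mult_trunc_self (hL : IsSizeFunction L R) {x : ℝ} (hx : x < T) (hR : R < T) :
    mult (SizeTheory.trunc T L) x T = multInf L x := by
  have hv : ∀ δ, 0 < δ → ∀ s, SizeTheory.trunc T L s (T - δ) = L s (T - δ) ∧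
      SizeTheory.trunc T L s (T + δ) = 0 :=
    fun δ h0 s => ⟨if_pos (by linarith), if_neg (by linarith)⟩
  unfold mult multInf
  apply csInf_eq_csInf_of_forall_exists_le
  · rintro v ⟨δ, h0, h1, rfl⟩
    obtain ⟨δ', h0', h2, h3, h4⟩ := exists_small x h0 (T - δ)
    refine ⟨_, ⟨δ', h0', h3, rfl⟩, ?_⟩
    simp only [(hv δ h0 _).1, (hv δ h0 _).2]
    have a1 := hL.box (s := x - δ) (s' := x + δ) (by linarith) h1 h4
    have a2 := hL.mono (s := x - δ) (s' := x - δ') (t := 1 / δ') (by linarith) (by linarith)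
    have a3 := hL.box (s := x + δ') (s' := x + δ) (by linarith) h1 h4
    have a4 := hL.box (s := x - δ) (s' := x - δ') (by linarith) (by linarith) h4
    have a5 := hL.box (s := x - δ') (s' := x + δ') (by linarith) (by linarith) h4
    have a6 := hL.mono (s := x + δ') (s' := x + δ) (t := T - δ) (by linarith) (by linarith)
    have a7 := hL.mono (s := x - δ) (s' := x - δ') (t := T - δ) (by linarith) (by linarith)
    omega
  · rintro v ⟨δ, h0, h1, rfl⟩
    set δ' := min δ (min (T - R) ((T - x) / 4)) with hδ'
    have h0' : 0 < δ' := lt_min h0 (lt_min (by linarith) (by linarith))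
    have d1 : δ' ≤ δ := min_le_left _ _
    have d2 : δ' ≤ T - R := (min_le_right _ _).trans (min_le_left _ _)
    have d3 : δ' ≤ (T - x) / 4 := (min_le_right _ _).trans (min_le_right _ _)
    refine ⟨_, ⟨δ', h0', by linarith, rfl⟩, ?_⟩
    simp only [(hv δ' h0' _).1, (hv δ' h0' _).2]
    have m1 := le_max_left T (1 / δ)
    have m2 := le_max_right T (1 / δ)
    have e1 := hL.const_right (s := x + δ') (t := T - δ') (t' := max T (1 / δ)) (by linarith)
      (by linarith) (by linarith) (by linarith)
    have e2 := hL.const_right (s := x - δ') (t := T - δ') (t' := max T (1 / δ)) (by linarith)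
      (by linarith) (by linarith) (by linarith)
    have a1 := hL.box (s := x - δ') (s' := x + δ') (by linarith)
      (show x + δ' < 1 / δ by linarith) m2
    have a2 := hL.mono (s := x + δ') (s' := x + δ) (t := 1 / δ) (by linarith) (by linarith)
    have a3 := hL.mono (s := x - δ) (s' := x - δ') (t := 1 / δ) (by linarith) (by linarith)
    omega

lemma mult_trunc_nonpos (hL : IsSizeFunction L R) {x y : ℝ} (hxy : x < y) (hy : T < y) :
    mult (SizeTheory.trunc T L) x y ≤ 0 := by
  set δ := min (y - T) ((y - x) / 4) with hδ
  have d0 : 0 < δ := lt_min (by linarith) (by linarith)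
  have d1 : δ ≤ y - T := min_le_left _ _
  have d2 : δ ≤ (y - x) / 4 := min_le_right _ _
  refine csInf_le ⟨0, ?_⟩ ⟨δ, d0, by linarith, ?_⟩
  · rintro v ⟨η, hη, hη', rfl⟩
    have := (hL.trunc T).box (s := x - η) (s' := x + η) (t := y - η) (t' := y + η)
      (by linarith) hη' (by linarith)
    omega
  · have : ∀ s u, T ≤ u → SizeTheory.trunc T L s u = 0 := fun s u hu => if_neg (not_lt.2 hu)
    rw [this _ (y - δ) (by linarith), this _ (y - δ) (by linarith),
      this _ (y + δ) (by linarith), this _ (y + δ) (by linarith)]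
    rfl

lemma bar_trunc (hL : IsSizeFunction L R) (hR : R < T) (q : Bar (SizeTheory.trunc T L)) :
    q.birth ≤ R ∧ (q.death = T ∨ q.death ≤ R) := by
  have h1 := q.idx_lt
  have h2 := q.lt
  rcases lt_trichotomy q.death T with h | h | h
  · rw [hL.mult_trunc_eq h] at h1
    have : q.death ≤ R := by
      by_contra! hc
      have := hL.mult_nonpos h2 hc
      omega
    exact ⟨by linarith, Or.inr this⟩
  · rw [h, hL.mult_trunc_self (h2.trans_eq h) hR] at h1
    refine ⟨?_, Or.inl h⟩
    by_contra! hc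
    have := hL.multInf_nonpos hc
    omega
  · have := hL.mult_trunc_nonpos h2 h
    omega

lemma lt_toNat_iff {n : ℕ} {v : ℤ} : (n : ℕ∞) < (v.toNat : ℕ∞) ↔ (n : ℤ) < v := by
  rw [Nat.cast_lt]
  omega

/-- The bars of the truncation are the cornerpoints off the diagonal. -/
lemma exists_bar_embedding (hL : IsSizeFunction L R) (hR : R < T) :
    ∃ ι : Bar (SizeTheory.trunc T L) → CPIdx (cpMult L), Function.Injective ι ∧
      (∀ q, (ι q).1 = (q.birth, if q.death = T then ⊤ else (q.death : WithTop ℝ))) ∧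
      ∀ z : CPIdx (cpMult L), z ∈ Set.range ι ∨ z.1.2 = (z.1.1 : WithTop ℝ) := by
  have ex : ∀ q : Bar (SizeTheory.trunc T L), ∃ z : CPIdx (cpMult L),
      z.1 = (q.birth, if q.death = T then ⊤ else (q.death : WithTop ℝ)) ∧ z.2.1 = q.idx := by
    intro q
    have h1 := q.idx_lt
    have h2 := q.lt
    refine ⟨⟨(q.birth, if q.death = T then ⊤ else (q.death : WithTop ℝ)), q.idx, ?_⟩, rfl, rfl⟩
    by_cases h : q.death = T
    · rw [if_pos h]
      rw [h, hL.mult_trunc_self (h2.trans_eq h) hR] at h1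
      exact lt_toNat_iff.2 h1
    · rw [if_neg h]
      have hlt : q.death < T := by
        rcases (hL.bar_trunc hR q).2 with h' | h'
        · exact absurd h' h
        · linarith
      rw [hL.mult_trunc_eq hlt] at h1
      change (q.idx : ℕ∞) < if q.birth = q.death then (⊤ : ℕ∞)
        else if q.birth < q.death then ((mult L q.birth q.death).toNat : ℕ∞) else 0
      rw [if_neg h2.ne, if_pos h2]
      exact lt_toNat_iff.2 h1
  choose ι hι hidx using ex
  have hinj : ∀ q q', (ι q).1 = (ι q').1 → (ι q).2.1 = (ι q').2.1 → q = q' := by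
    intro q q' h h'
    rw [hidx, hidx] at h'
    rw [hι, hι, Prod.mk.injEq] at h
    refine Bar.ext h.1 ?_ h'
    have h2 := h.2
    split_ifs at h2 with a b b
    · rw [a, b]
    · exact absurd h2 (WithTop.coe_ne_top).symm
    · exact absurd h2 WithTop.coe_ne_top
    · exact WithTop.coe_injective h2
  refine ⟨ι, fun q q' h => hinj q q' (by rw [h]) (by rw [h]), hι, ?_⟩
  have hmem : ∀ z : CPIdx (cpMult L), ∀ q : Bar (SizeTheory.trunc T L),
      z.1 = (ι q).1 → z.2.1 = q.idx → z ∈ Set.range ι := by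
    intro z q h h'
    refine ⟨q, ?_⟩
    obtain ⟨p, n, hn⟩ := z
    have hq := hidx q
    generalize ι q = w at h hq
    obtain ⟨p', n', hn'⟩ := w
    simp only at h h' hq
    subst h
    subst h'
    subst hq
    rfl
  rintro ⟨⟨x, y⟩, n, hn⟩
  induction y using WithTop.recTopCoe with
  | top =>
    left
    have h1 : (n : ℤ) < multInf L x := lt_toNat_iff.1 hn
    have hx : x < T := by
      by_contra! hc
      have := hL.multInf_nonpos (hR.trans_le hc)
      omega
    refine hmem _ ⟨x, T, n, hx, by rwa [hL.mult_trunc_self hx hR]⟩ ?_ rfl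
    rw [hι, if_pos rfl]
  | coe y =>
    change (n : ℕ∞) < if x = y then (⊤ : ℕ∞)
        else if x < y then ((mult L x y).toNat : ℕ∞) else 0 at hn
    split_ifs at hn with h1 h2
    · right
      exact congrArg _ h1.symm
    · left
      have h3 : (n : ℤ) < mult L x y := lt_toNat_iff.1 hn
      have hy : y < T := by
        by_contra! hc
        have := hL.mult_nonpos h2 (hR.trans_le hc)
        omega
      refine hmem _ ⟨x, y, n, h2, by rwa [hL.mult_trunc_eq hy]⟩ ?_ rfl
      rw [hι, if_neg hy.ne]
    · simp at hn

end IsSizeFunction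

/-! ### Assembling the bijection -/

/-- Translation of bars along the diagonal. -/
def Bar.shift {L L' : ℝ → ℝ → ℕ} (h : ℝ) (H : ∀ s t, L s t = L' (s + h) (t + h)) (q : Bar L) :
    Bar L' where
  birth := q.birth + h
  death := q.death + h
  idx := q.idx
  lt := by linarith [q.lt]
  idx_lt := by
    have := q.idx_lt
    have e : mult L q.birth q.death = mult L' (q.birth + h) (q.death + h) := by
      unfold mult
      congr 1
      ext v
      refine exists_congr fun δ => and_congr_right fun _ => and_congr ?_ ?_
      · constructor <;> intro h <;> linarith
      · simp only [H, add_right_comm _ δ h, sub_add_eq_add_sub]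
    rwa [e] at this

lemma exists_equiv_of_injective {X Y I : Type} {f : I → X} {g : I → Y}
    (hf : Function.Injective f) (hg : Function.Injective g)
    (hc : Cardinal.mk ↥(Set.range f)ᶜ = Cardinal.mk ↥(Set.range g)ᶜ) :
    ∃ σ : X ≃ Y, (∀ i, σ (f i) = g i) ∧ ∀ x, x ∉ Set.range f → σ x ∉ Set.range g := by
  classical
  obtain ⟨e⟩ := Cardinal.eq.1 hc
  refine ⟨(Equiv.Set.sumCompl (Set.range f)).symm.trans
    (((((Equiv.ofInjective f hf).symm.trans (Equiv.ofInjective g hg)).sumCongr e)).trans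
      (Equiv.Set.sumCompl (Set.range g))), fun i => ?_, fun x hx => ?_⟩
  · have h1 : (Equiv.Set.sumCompl (Set.range f)).symm (f i) = Sum.inl ⟨f i, i, rfl⟩ :=
      Equiv.Set.sumCompl_symm_apply_of_mem (Set.mem_range_self i)
    have h2 : (Equiv.ofInjective f hf).symm ⟨f i, i, rfl⟩ = i :=
      Equiv.ofInjective_symm_apply hf i
    simp [h1, h2]
  · have h1 : (Equiv.Set.sumCompl (Set.range f)).symm x = Sum.inr ⟨x, hx⟩ :=
      Equiv.Set.sumCompl_symm_apply_of_notMem hx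
    simp only [Equiv.trans_apply, h1, Equiv.sumCongr_apply, Sum.map_inr,
      Equiv.Set.sumCompl_apply_inr]
    exact (e ⟨x, hx⟩).2

lemma mk_compl_eq_continuum {m : ℝ × WithTop ℝ → ℕ∞} (hm : ∀ x : ℝ, m (x, (x : WithTop ℝ)) = ⊤)
    (S : Set (CPIdx m)) (hS : ∀ z ∈ S, z.1.2 ≠ (z.1.1 : WithTop ℝ)) :
    Cardinal.mk ↥Sᶜ = Cardinal.continuum := by
  apply le_antisymm
  · have hinj : Function.Injective
        (fun z : CPIdx m => ((z.1.1, z.1.2, z.2.1) : ℝ × WithTop ℝ × ℕ)) := by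
      rintro ⟨⟨x, y⟩, n, hn⟩ ⟨⟨x', y'⟩, n', hn'⟩ h
      simp only [Prod.mk.injEq] at h
      obtain ⟨rfl, rfl, rfl⟩ := h
      rfl
    calc Cardinal.mk ↥Sᶜ ≤ Cardinal.mk (CPIdx m) := Cardinal.mk_set_le _
      _ ≤ Cardinal.mk (ℝ × WithTop ℝ × ℕ) := Cardinal.mk_le_of_injective hinj
      _ = Cardinal.mk ℝ * ((Cardinal.mk ℝ + 1) * Cardinal.aleph0) := by
        rw [Cardinal.mk_prod, Cardinal.mk_prod,
          show Cardinal.mk (WithTop ℝ) = Cardinal.mk ℝ + 1 from Cardinal.mk_option]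
        simp
      _ = Cardinal.continuum := by
        rw [Cardinal.mk_real, Cardinal.add_one_eq Cardinal.aleph0_le_continuum,
          Cardinal.continuum_mul_aleph0, Cardinal.continuum_mul_self]
  · rw [← Cardinal.mk_real]
    have hd : ∀ x : ℝ, ((0 : ℕ) : ℕ∞) < m (x, (x : WithTop ℝ)) := by
      intro x
      rw [hm]
      exact ENat.natCast_lt_top 0
    refine Cardinal.mk_le_of_injective
      (f := fun x : ℝ => (⟨⟨(x, (x : WithTop ℝ)), 0, hd x⟩, fun h => hS _ h rfl⟩ : ↥Sᶜ)) ?_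
    intro x x' h
    exact congrArg (fun w : ↥Sᶜ => w.1.1.1) h

lemma cpMult_diag (ℓ : ℝ → ℝ → ℕ) (x : ℝ) : cpMult ℓ (x, (x : WithTop ℝ)) = ⊤ :=
  if_pos rfl

/-- Reduction of the matching distance to a partial matching of cornerpoints that leaves out only
points close to the diagonal. -/
lemma dMatch_le_of_partial_matching {ℓ₁ ℓ₂ : ℝ → ℝ → ℕ} {I : Type} {c : ℝ≥0∞}
    {f : I → CPIdx (cpMult ℓ₁)} {g : I → CPIdx (cpMult ℓ₂)}
    (hf : Function.Injective f) (hg : Function.Injective g)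
    (hfd : ∀ i, (f i).1.2 ≠ ((f i).1.1 : WithTop ℝ))
    (hgd : ∀ i, (g i).1.2 ≠ ((g i).1.1 : WithTop ℝ))
    (hfg : ∀ i, deltaCP (f i).1 (g i).1 ≤ c)
    (hf' : ∀ z, z ∉ Set.range f → diagHalf z.1 ≤ c)
    (hg' : ∀ z, z ∉ Set.range g → diagHalf z.1 ≤ c) : dMatch ℓ₁ ℓ₂ ≤ c := by
  obtain ⟨σ, h1, h2⟩ := exists_equiv_of_injective hf hg (by
    rw [mk_compl_eq_continuum (cpMult_diag ℓ₁), mk_compl_eq_continuum (cpMult_diag ℓ₂)]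
    · rintro _ ⟨i, rfl⟩
      exact hgd i
    · rintro _ ⟨i, rfl⟩
      exact hfd i)
  refine (iInf_le _ σ).trans (iSup_le fun z => ?_)
  by_cases hz : z ∈ Set.range f
  · obtain ⟨i, rfl⟩ := hz
    rw [h1]
    exact hfg i
  · exact (min_le_right _ _).trans (max_le (hf' z hz) (hg' _ (h2 z hz)))

section Unmatched

variable {L : ℝ → ℝ → ℕ} {R T c : ℝ} {ι : Bar (trunc T L) → CPIdx (cpMult L)}

lemma ne_diag_of_bar (hι : ∀ q, (ι q).1 = (q.birth, if q.death = T then ⊤ else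
    (q.death : WithTop ℝ))) (q : Bar (trunc T L)) : (ι q).1.2 ≠ ((ι q).1.1 : WithTop ℝ) := by
  rw [hι]
  simp only
  split_ifs
  · exact WithTop.coe_ne_top.symm
  · exact fun h => q.lt.ne' (WithTop.coe_injective h)

lemma diagHalf_le_of_unmatched (hL : IsSizeFunction L R) (hT : R + 2 * c < T) (hc : 0 ≤ c)
    (hι : ∀ q, (ι q).1 = (q.birth, if q.death = T then ⊤ else (q.death : WithTop ℝ)))
    (hι' : ∀ z, z ∈ Set.range ι ∨ z.1.2 = (z.1.1 : WithTop ℝ)) {I : Type}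
    {f : I → Bar (trunc T L)} (hf : ∀ q, q.birth + 2 * c < q.death → q ∈ Set.range f)
    (z : CPIdx (cpMult L)) (hz : z ∉ Set.range (ι ∘ f)) : diagHalf z.1 ≤ ENNReal.ofReal c := by
  rcases hι' z with ⟨q, rfl⟩ | h
  · have hq : q.death ≤ q.birth + 2 * c := by
      by_contra! hlt
      obtain ⟨i, rfl⟩ := hf q hlt
      exact hz ⟨i, rfl⟩
    have hb := (hL.bar_trunc (by linarith) q).1
    rw [hι, if_neg (by linarith : q.death < T).ne]
    exact ENNReal.ofReal_le_ofReal (by linarith)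
  · unfold diagHalf
    rw [h]
    change ENNReal.ofReal ((z.1.1 - z.1.1) / 2) ≤ _
    simp

end Unmatched

/-- Matching Stability Theorem: if `max_P |φ(P) - ψ(P)| ≤ ε`, then the matching distance
between the associated 1-dimensional size functions is at most `ε`. -/
theorem matching_stability {M : Type*} [TopologicalSpace M] [Nonempty M]
    [CompactSpace M] [LocallyConnectedSpace M] [T2Space M]
    (φ ψ : M → ℝ) (hφ : Continuous φ) (hψ : Continuous ψ)
    (ε : ℝ) (h : ∀ P : M, |φ P - ψ P| ≤ ε) :
    dMatch (size1 φ) (size1 ψ) ≤ ENNReal.ofReal ε := by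
  have hε : 0 ≤ ε := (abs_nonneg _).trans (h (Classical.arbitrary M))
  obtain ⟨C, hC⟩ := isCompact_univ.exists_bound_of_continuousOn hφ.continuousOn
  have hCφ : ∀ P, |φ P| ≤ C := fun P => hC P trivial
  set ψ' : M → ℝ := fun P => ψ P - ε with hψ'
  have hψ'c : Continuous ψ' := hψ.sub continuous_const
  have hle : ∀ P, ψ' P ≤ φ P := fun P => by
    have := (abs_le.1 (h P)).1
    simp only [hψ']
    linarith
  have hge : ∀ P, φ P ≤ ψ' P + 2 * ε := fun P => by
    have := (abs_le.1 (h P)).2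
    simp only [hψ']
    linarith
  set R := C + 2 * ε with hR
  have hφR : ∀ P, |φ P| ≤ R := fun P => (hCφ P).trans (by linarith)
  have hψR : ∀ P, |ψ P| ≤ R := fun P => by
    obtain ⟨h1, h2⟩ := abs_le.1 (h P)
    obtain ⟨h3, h4⟩ := abs_le.1 (hCφ P)
    exact abs_le.2 ⟨by linarith, by linarith⟩
  have hψ'R : ∀ P, |ψ' P| ≤ R := fun P => by
    have h1 := hle P
    have h2 := hge P
    obtain ⟨h3, h4⟩ := abs_le.1 (hCφ P)
    exact abs_le.2 ⟨by linarith, by linarith⟩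
  set T := R + 2 * ε + 1 with hT
  have hV : IsSizeFunction (size1 φ) R := by
    rw [size1_eq_mixedSize]
    exact isSizeFunction_mixedSize hφ (fun _ => le_rfl) hφR hφR
  have hI := isSizeFunction_mixedSize hφ hle hφR hψ'R
  have hW' := isSizeFunction_mixedSize hψ'c (fun _ => le_rfl) hψ'R hψ'R
  have hW : IsSizeFunction (size1 ψ) R := by
    rw [size1_eq_mixedSize]
    exact isSizeFunction_mixedSize hψ (fun _ => le_rfl) hψR hψR
  have hshift : ∀ s t, trunc T (mixedSize ψ' ψ') s t
      = trunc (T + ε) (size1 ψ) (s + ε) (t + ε) := by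
    intro s t
    simp only [trunc, add_lt_add_iff_right, size1_eq_mixedSize, mixedSize, hψ',
      sub_le_iff_le_add]
  have hshift' : ∀ s t, trunc (T + ε) (size1 ψ) s t
      = trunc T (mixedSize ψ' ψ') (s + -ε) (t + -ε) := by
    intro s t
    rw [hshift, neg_add_cancel_right, neg_add_cancel_right]
  obtain ⟨f, hfinj, hf, hf'⟩ := (hV.trunc T).birth_matching (hI.trunc T) (c := 2 * ε)
    (by linarith)
    (by
      intro s s' t h1 h2
      unfold trunc
      split_ifs
      · rw [size1_eq_mixedSize]
        exact mixedSize_box hφ (fun P hP => hP.trans h1) h2 (fun _ => le_rfl)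
          (fun P hP => (hle P).trans hP)
      · exact le_rfl)
    (by
      intro s s' t h1 h2
      unfold trunc
      split_ifs
      · rw [size1_eq_mixedSize]
        exact mixedSize_box hφ (fun P hP => hP.trans h1) h2 hle
          (fun P hP => (hge P).trans (by linarith))
      · linarith
      · simpa using hI.mono h1 h2
      · exact le_rfl)
  obtain ⟨g, hginj, hg, hg'⟩ := (hW'.trunc T).death_matching (hI.trunc T) (c := 2 * ε)
    (by linarith)
    (by
      intro s t t' h1 h2
      have h3 : ∀ P, φ P ≤ s → ψ' P ≤ s := fun P hP => (hle P).trans hP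
      unfold trunc
      split_ifs
      · have := mixedSize_box hψ'c h3 h1 (fun _ => le_rfl) (fun P hP => hP.trans h2)
        linarith
      · simpa using mixedSize_le hψ'c h3 h1 (fun _ => le_rfl)
      · linarith
      · exact le_rfl)
    (by
      intro s t t' h1 h2
      have h3 : ∀ P, ψ' P ≤ s - 2 * ε → φ P ≤ s := fun P hP => (hge P).trans (by linarith)
      unfold trunc
      split_ifs
      · have := mixedSize_box hφ h3 h1 hle (fun P hP => hP.trans h2)
        linarith
      · simpa using mixedSize_le hφ h3 h1 hle
      · linarith
      · exact le_rfl)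
  obtain ⟨ι, hιinj, hι, hι'⟩ := hV.exists_bar_embedding (T := T) (by linarith)
  obtain ⟨κ, hκinj, hκ, hκ'⟩ := hW.exists_bar_embedding (T := T + ε) (by linarith)
  refine dMatch_le_of_partial_matching (f := ι ∘ f) (g := κ ∘ fun p => (g p).shift ε hshift)
    (hιinj.comp hfinj) (hκinj.comp fun p p' hpp => hginj ?_)
    (fun p => ne_diag_of_bar hι _) (fun p => ne_diag_of_bar hκ _) (fun p => ?_)
    (diagHalf_le_of_unmatched hV (by linarith) hε hι hι' hf')
    (diagHalf_le_of_unmatched hW (by linarith) hε hκ hκ' fun q hq => ?_)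
  · have h1 := congrArg Bar.birth hpp
    have h2 := congrArg Bar.death hpp
    have h3 := congrArg Bar.idx hpp
    exact Bar.ext (add_right_cancel h1) (add_right_cancel h2) h3
  · obtain ⟨h1, h2, h3⟩ := hf p
    obtain ⟨h4, h5, h6⟩ := hg p
    have hfT := (hV.bar_trunc (by linarith) (f p)).2
    have hgT := (hW'.bar_trunc (by linarith) (g p)).2
    refine (min_le_left _ _).trans (max_le ?_ ?_)
    · simp only [Function.comp_apply, hι, hκ, Bar.shift]
      exact ENNReal.ofReal_le_ofReal (abs_le.2 ⟨by linarith, by linarith⟩)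
    · simp only [Function.comp_apply, hι, hκ, Bar.shift, add_left_inj]
      have hiff : (f p).death = T ↔ (g p).death = T := by
        constructor
        · intro e
          rcases hgT with e' | e'
          · exact e'
          · linarith
        · intro e
          rcases hfT with e' | e'
          · exact e'
          · linarith
      by_cases e : (g p).death = T
      · rw [if_pos (hiff.2 e), if_pos e]
        exact zero_le
      · rw [if_neg (fun e' => e (hiff.1 e')), if_neg e]
        exact ENNReal.ofReal_le_ofReal (abs_le.2 ⟨by linarith, by linarith⟩)
  · obtain ⟨p, hp⟩ := hg' (q.shift (-ε) hshift') (by simp only [Bar.shift]; linarith)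
    exact ⟨p, by ext <;> simp [hp, Bar.shift]⟩

end SizeTheory
end
end

section
/- For every (x, y) ∈ Δ⁺ = {(x, y) ∈ ℝ^k × ℝ^k : x_i < y_i for all i} there exists one and only one admissible pair (l, b) such that (x, y) belongs to the half-plane π_{(l,b)}, i.e. such that x = s·l + b and y = t·l + b for some real numbers s < t. -/
open scoped ENNReal Manifold
open Filter

noncomputable section

namespace SizeTheory

/-- For every `(x, y) ∈ Δ⁺` there exists one and only one admissible pair `(l, b)` such
that `(x, y)` belongs to the half-plane `π_{(l,b)}`. -/
theorem foliation_unique {k : ℕ} (hk : 0 < k) (x y : Fin k → ℝ) (hxy : ∀ i, x i < y i) :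
    ∃! p : (Fin k → ℝ) × (Fin k → ℝ), Admissible p.1 p.2 ∧
      ∃ s t : ℝ, s < t ∧ (∀ i, x i = s * p.1 i + p.2 i) ∧
        (∀ i, y i = t * p.1 i + p.2 i) := by
  have : Nonempty (Fin k) := ⟨⟨0, hk⟩⟩
  have hd : ∀ i, 0 < y i - x i := fun i => sub_pos.mpr (hxy i)
  have hsum : 0 < ∑ i, (y i - x i) ^ 2 :=
    Finset.sum_pos (fun i _ => pow_pos (hd i) 2) Finset.univ_nonempty
  obtain ⟨n, hn⟩ : ∃ n, n = Real.sqrt (∑ i, (y i - x i) ^ 2) := ⟨_, rfl⟩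
  have hn0 : 0 < n := hn ▸ Real.sqrt_pos.mpr hsum
  have hn2 : n ^ 2 = ∑ i, (y i - x i) ^ 2 := hn ▸ Real.sq_sqrt hsum.le
  obtain ⟨l, hl⟩ : ∃ l : Fin k → ℝ, ∀ i, l i = (y i - x i) / n := ⟨_, fun _ => rfl⟩
  have hlpos : ∀ i, 0 < l i := fun i => hl i ▸ div_pos (hd i) hn0
  have hL : 0 < ∑ i, l i := Finset.sum_pos (fun i _ => hlpos i) Finset.univ_nonempty
  have hnl : ∀ i, n * l i = y i - x i := fun i => by
    rw [hl i]
    field_simp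
  obtain ⟨s, hs⟩ : ∃ s, s = (∑ i, x i) / ∑ i, l i := ⟨_, rfl⟩
  refine ⟨(l, fun i => x i - s * l i), ⟨⟨?_, hlpos, ?_⟩, s, s + n, by linarith, ?_, ?_⟩, ?_⟩
  · have h1 : ∑ i, l i ^ 2 = 1 := by
      simp only [hl, div_pow]
      rw [← Finset.sum_div, ← hn2, div_self (pow_pos hn0 2).ne']
    simp [h1]
  · rw [Finset.sum_sub_distrib, ← Finset.mul_sum, hs, div_mul_cancel₀ _ hL.ne', sub_self]
  · intro i
    ring
  · intro i
    linear_combination -hnl i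
  · rintro ⟨l', b'⟩ ⟨⟨h1, -, hb⟩, s', t', hst, hx, hy⟩
    dsimp only at h1 hb hx hy
    have hdiff : ∀ i, y i - x i = (t' - s') * l' i := fun i => by
      rw [hx i, hy i]
      ring
    have hn' : n = t' - s' := by
      have h2 : ∑ i, (y i - x i) ^ 2 = (t' - s') ^ 2 * ∑ i, l' i ^ 2 := by
        simp only [hdiff, mul_pow, Finset.mul_sum]
      rw [hn, h2, Real.sqrt_mul (sq_nonneg _), h1, mul_one, Real.sqrt_sq (sub_pos.mpr hst).le]
    have hll : l' = l := by
      funext i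
      apply mul_left_cancel₀ hn0.ne'
      rw [hnl i, hdiff i, hn']
    subst hll
    have hss : s = s' := by
      rw [hs, div_eq_iff hL.ne', Finset.sum_congr rfl fun i _ => hx i,
        Finset.sum_add_distrib, hb, add_zero, Finset.mul_sum]
    refine Prod.ext rfl (funext fun i => ?_)
    simp only [hx i, hss]
    ring

end SizeTheory
end
end

section
/- (Reduction Theorem.) Let (M, φ) be a size pair with φ : M → ℝ^k continuous and let (l, b) be an admissible pair. Then for every (x, y) = (s·l + b, t·l + b) ∈ π_{(l,b)} the following equality holds: ℓ_{(M,φ)}(x, y) = ℓ_{(M, F_{(l,b)}^φ)}(s, t), where ℓ_{(M, F_{(l,b)}^φ)} is the 1-dimensional size function associated with the real-valued function F_{(l,b)}^φ. -/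
open scoped ENNReal Manifold
open Filter

noncomputable section

namespace SizeTheory

theorem Admissible.pos_dim {k : ℕ} {l b : Fin k → ℝ} (h : Admissible l b) : 0 < k := by
  rcases Nat.eq_zero_or_pos k with rfl | hk
  · simp [Admissible] at h
  · exact hk

theorem Fpair_le_iff {M : Type*} {k : ℕ} (φ : M → Fin k → ℝ) {l b : Fin k → ℝ}
    (h : Admissible l b) (r : ℝ) (P : M) :
    Fpair φ l b P ≤ r ↔ ∀ i, φ P i ≤ r * l i + b i := by
  have : Nonempty (Fin k) := ⟨⟨0, h.pos_dim⟩⟩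
  rw [Fpair, ciSup_le_iff (Set.finite_range _).bddAbove]
  refine forall_congr' fun i => ?_
  rw [div_le_iff₀ (h.2.1 i), sub_le_iff_le_add]

/-- Reduction Theorem: on the half-plane `π_{(l,b)}`, the `k`-dimensional size function
coincides with the 1-dimensional size function of the measuring function `F_{(l,b)}^φ`. -/
theorem reduction_theorem {k : ℕ} {M : Type*} [TopologicalSpace M] [Nonempty M]
    [CompactSpace M] [LocallyConnectedSpace M] [T2Space M]
    (φ : M → Fin k → ℝ) (hφ : Continuous φ)
    (l b : Fin k → ℝ) (hadm : Admissible l b) (s t : ℝ) (hst : s < t) :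
    sizek φ (fun i => s * l i + b i) (fun i => t * l i + b i) =
      size1 (Fpair φ l b) s t := by
  simp only [sizek, size1, Fpair_le_iff φ hadm]

end SizeTheory
end
end
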